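/- arXiv:2007.02212 — 6 statements merged into one kernel-verified Lean document; each statement's English description precedes it below -/
import Mathlib

section
/- Let d ≥ 1 be an integer and α ∈ (1,2). Let V ∈ C¹(ℝ^d) be such that e^{−V}|∇V| ∈ L¹(ℝ^d; dx) ∩ C_b(ℝ^d). Then the fractional drift b is locally (2−α)-Hölder continuous: for every compact set K ⊂ ℝ^d there exists a constant C_K > 0 such that |b(x) − b(y)| ≤ C_K |x−y|^{2−α} for all x, y ∈ K. -/
open MeasureTheory Real Filter
open scoped RealInnerProductSpace

/-- The Riesz constant `C_{d,2-α} = Γ((d-(2-α))/2) / (2^{2-α} π^{d/2} Γ((2-α)/2))`. -/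
noncomputable def rieszC (d : ℕ) (α : ℝ) : ℝ :=
  Real.Gamma (((d : ℝ) - (2 - α)) / 2) /
    (2 ^ (2 - α) * Real.pi ^ ((d : ℝ) / 2) * Real.Gamma ((2 - α) / 2))

/-- The fractional drift
`b(x) = -C_{d,2-α} e^{V(x)} ∫ e^{-V(y)} ∇V(y) |x-y|^{-(d+α-2)} dy`. -/
noncomputable def fracDrift (d : ℕ) (α : ℝ) (V : EuclideanSpace ℝ (Fin d) → ℝ) :
    EuclideanSpace ℝ (Fin d) → EuclideanSpace ℝ (Fin d) := fun x =>
  (-(rieszC d α * Real.exp (V x))) •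
    ∫ y, (Real.exp (-(V y)) * ‖x - y‖ ^ (-((d : ℝ) + α - 2))) • gradient V y

/-- Radial profile dominating the kernel differences. -/
noncomputable def profG (p t : ℝ) : ℝ := if t ≤ 1 then t ^ (-p) else t ^ (-p - 1)

lemma profG_nonneg (p : ℝ) {t : ℝ} (ht : 0 ≤ t) : 0 ≤ profG p t := by
  unfold profG; split_ifs <;> positivity

lemma profG_aux {p u v : ℝ} (hp : 0 < p) (hu : 0 ≤ u) (huv : u ≤ v) (h1 : v ≤ u + 1) :
    |u ^ (-p) - v ^ (-p)| ≤ (1 + p) * (profG p u + profG p v) := by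
  have hGu := profG_nonneg p hu
  have hGv := profG_nonneg p (hu.trans huv)
  rcases hu.eq_or_lt with rfl | hu0
  · have hv1 : v ≤ 1 := by linarith
    rw [Real.zero_rpow (by linarith), zero_sub, abs_neg, abs_of_nonneg (by positivity)]
    have : profG p v = v ^ (-p) := by simp [profG, hv1]
    nlinarith
  · have hv0 : 0 < v := hu0.trans_le huv
    have hle : v ^ (-p) ≤ u ^ (-p) := Real.rpow_le_rpow_of_nonpos hu0 huv (by linarith)
    rw [abs_of_nonneg (by linarith)]
    have hvp : 0 ≤ v ^ (-p) := by positivity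
    by_cases hu1 : u ≤ 1
    · have : profG p u = u ^ (-p) := by simp [profG, hu1]
      nlinarith
    · have hG : profG p u = u ^ (-p - 1) := by simp [profG, hu1]
      have e1 : v ^ (-p) = u ^ (-p) * (v / u) ^ (-p) := by
        rw [← Real.mul_rpow hu (by positivity)]; congr 1; field_simp
      have e2 : u ^ (-p) = u ^ (-p - 1) * u := by
        rw [Real.rpow_sub_one hu0.ne']; field_simp
      have e3 : 1 - p * (v / u - 1) ≤ (v / u) ^ (-p) := by
        rw [Real.rpow_def_of_pos (by positivity)]
        have h2 := Real.add_one_le_exp (Real.log (v / u) * -p)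
        have h3 := Real.log_le_sub_one_of_pos (show 0 < v / u by positivity)
        nlinarith
      have e4 : u ^ (-p) - v ^ (-p) ≤ u ^ (-p) * (p * (v / u - 1)) := by
        rw [e1]
        have : 0 ≤ u ^ (-p) := by positivity
        nlinarith
      have e5 : u ^ (-p) * (p * (v / u - 1)) = profG p u * (p * (v - u)) := by
        rw [hG, e2]; field_simp
      rw [e5] at e4
      have e6 : profG p u * (p * (v - u)) ≤ profG p u * p := by
        apply mul_le_mul_of_nonneg_left _ hGu
        nlinarith
      nlinarith [mul_nonneg hp.le hGv]

lemma profG_diff {p u v : ℝ} (hp : 0 < p) (hu : 0 ≤ u) (hv : 0 ≤ v) (h1 : |u - v| ≤ 1) :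
    |u ^ (-p) - v ^ (-p)| ≤ (1 + p) * (profG p u + profG p v) := by
  rw [abs_le] at h1
  rcases le_total u v with h | h
  · exact profG_aux hp hu h (by linarith)
  · rw [abs_sub_comm, add_comm (profG p u)]
    exact profG_aux hp hv h (by linarith)

lemma profG_scaled {p a b r : ℝ} (hp : 0 < p) (ha : 0 ≤ a) (hb : 0 ≤ b) (hr : 0 < r)
    (h1 : |a - b| ≤ r) :
    |a ^ (-p) - b ^ (-p)| ≤ r ^ (-p) * ((1 + p) * (profG p (r⁻¹ * a) + profG p (r⁻¹ * b))) := by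
  have key := profG_diff (u := r⁻¹ * a) (v := r⁻¹ * b) hp (by positivity) (by positivity) (by
    rw [← mul_sub, abs_mul, abs_of_pos (inv_pos.2 hr), inv_mul_le_iff₀ hr]; linarith)
  have ea : ∀ c : ℝ, 0 ≤ c → c ^ (-p) = r ^ (-p) * (r⁻¹ * c) ^ (-p) := by
    intro c hc
    rw [← Real.mul_rpow hr.le (by positivity)]; congr 1; field_simp
  rw [ea a ha, ea b hb, ← mul_sub, abs_mul, abs_of_nonneg (by positivity)]
  exact mul_le_mul_of_nonneg_left key (by positivity)

lemma profG_integrable {d : ℕ} (hd : 1 ≤ d) {p : ℝ} (hp1 : (d : ℝ) - 1 < p) (hp2 : p < d) :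
    Integrable (fun z : EuclideanSpace ℝ (Fin d) => profG p ‖z‖) := by
  have : Nonempty (Fin d) := ⟨⟨0, hd⟩⟩
  have : Nontrivial (EuclideanSpace ℝ (Fin d)) := inferInstance
  rw [integrable_fun_norm_addHaar (μ := volume) (f := profG p)]
  rw [finrank_euclideanSpace, Fintype.card_fin]
  have hc : ((d - 1 : ℕ) : ℝ) = (d : ℝ) - 1 := by push_cast [hd]; ring
  rw [← Set.Ioc_union_Ioi_eq_Ioi (zero_le_one (α := ℝ))]
  apply IntegrableOn.union
  · have : IntegrableOn (fun t : ℝ => t ^ ((d : ℝ) - 1 - p)) (Set.Ioc 0 1) := by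
      rw [← intervalIntegrable_iff_integrableOn_Ioc_of_le zero_le_one]
      exact intervalIntegral.intervalIntegrable_rpow' (by linarith)
    refine this.congr_fun ?_ measurableSet_Ioc
    intro t ht
    simp only [profG, ht.2, if_true, smul_eq_mul]
    rw [← Real.rpow_natCast, ← Real.rpow_add ht.1, hc]; congr 1
  · have : IntegrableOn (fun t : ℝ => t ^ ((d : ℝ) - 1 - p - 1)) (Set.Ioi 1) :=
      integrableOn_Ioi_rpow_of_lt (by linarith) one_pos
    refine this.congr_fun ?_ measurableSet_Ioi
    intro t ht
    have ht' : (1 : ℝ) < t := ht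
    simp only [profG, not_le.2 ht', if_false, smul_eq_mul]
    rw [← Real.rpow_natCast, ← Real.rpow_add (by linarith), hc]; congr 1; ring

lemma profG_shift_integrable {d : ℕ} (hd : 1 ≤ d) {p : ℝ} (hp1 : (d : ℝ) - 1 < p) (hp2 : p < d)
    {r : ℝ} (hr : 0 < r) (x : EuclideanSpace ℝ (Fin d)) :
    Integrable (fun y : EuclideanSpace ℝ (Fin d) => profG p (r⁻¹ * ‖x - y‖)) := by
  have h := ((profG_integrable hd hp1 hp2).comp_smul (inv_ne_zero hr.ne')).comp_sub_left x
  simpa [norm_smul, abs_of_pos hr] using h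

lemma profG_shift_integral {d : ℕ} {p r : ℝ} (hr : 0 < r) (x : EuclideanSpace ℝ (Fin d)) :
    ∫ y : EuclideanSpace ℝ (Fin d), profG p (r⁻¹ * ‖x - y‖) =
      r ^ d * ∫ z : EuclideanSpace ℝ (Fin d), profG p ‖z‖ := by
  rw [integral_sub_left_eq_self (fun y : EuclideanSpace ℝ (Fin d) => profG p (r⁻¹ * ‖y‖)) volume x]
  have := Measure.integral_comp_inv_smul_of_nonneg (volume : Measure (EuclideanSpace ℝ (Fin d)))
    (fun z => profG p ‖z‖) hr.le
  simpa [norm_smul, abs_of_pos hr] using this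

/-- Hölder bound for Riesz-type potentials of bounded integrable fields. -/
lemma potential_holder {d : ℕ} (hd : 1 ≤ d) {p : ℝ} (hp : 0 < p) (hp1 : (d : ℝ) - 1 < p)
    (hp2 : p < d) (g : EuclideanSpace ℝ (Fin d) → EuclideanSpace ℝ (Fin d))
    (hg : Integrable g) {M : ℝ} (hM : ∀ y, ‖g y‖ ≤ M) :
    ∃ A : ℝ, 0 ≤ A ∧ ∀ x x', ‖(∫ y, ‖x - y‖ ^ (-p) • g y) - ∫ y, ‖x' - y‖ ^ (-p) • g y‖
      ≤ A * ‖x - x'‖ ^ ((d : ℝ) - p) := by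
  have hM0 : 0 ≤ M := (norm_nonneg _).trans (hM 0)
  have hInt : ∀ x, Integrable (fun y => ‖x - y‖ ^ (-p) • g y) := by
    intro x
    have h1 := profG_shift_integrable hd hp1 hp2 one_pos x
    simp only [inv_one, one_mul] at h1
    refine ((h1.const_mul M).add hg.norm).mono' ?_ ?_
    · have hm : AEStronglyMeasurable
          (fun y : EuclideanSpace ℝ (Fin d) => ‖x - y‖ ^ (-p)) volume :=
        (by fun_prop : Measurable fun y : EuclideanSpace ℝ (Fin d) =>
          ‖x - y‖ ^ (-p)).aestronglyMeasurable
      exact hm.smul hg.1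
    · refine Eventually.of_forall fun y => ?_
      simp only [Pi.add_apply]
      rw [norm_smul, Real.norm_of_nonneg (by positivity)]
      have hG := profG_nonneg p (norm_nonneg (x - y))
      by_cases h : ‖x - y‖ ≤ 1
      · have e : profG p ‖x - y‖ = ‖x - y‖ ^ (-p) := by simp [profG, h]
        rw [← e]
        nlinarith [hM y, norm_nonneg (g y)]
      · have : ‖x - y‖ ^ (-p) ≤ 1 :=
          Real.rpow_le_one_of_one_le_of_nonpos (not_le.1 h).le (by linarith)
        nlinarith [norm_nonneg (g y), mul_nonneg hM0 hG]
  set J := ∫ z : EuclideanSpace ℝ (Fin d), profG p ‖z‖ with hJ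
  have hJ0 : 0 ≤ J := integral_nonneg fun z => profG_nonneg p (norm_nonneg z)
  refine ⟨2 * M * (1 + p) * J, by positivity, fun x x' => ?_⟩
  rcases eq_or_ne x x' with rfl | hne
  · rw [sub_self, norm_zero]; positivity
  have hr : 0 < ‖x - x'‖ := norm_pos_iff.2 (sub_ne_zero.2 hne)
  set r := ‖x - x'‖ with hrdef
  rw [← integral_sub (hInt x) (hInt x')]
  have i1 := profG_shift_integrable hd hp1 hp2 hr x
  have i2 := profG_shift_integrable hd hp1 hp2 hr x'
  have hb : ∀ y, ‖‖x - y‖ ^ (-p) • g y - ‖x' - y‖ ^ (-p) • g y‖ ≤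
      (r ^ (-p) * (1 + p) * M) * (profG p (r⁻¹ * ‖x - y‖) + profG p (r⁻¹ * ‖x' - y‖)) := by
    intro y
    rw [← sub_smul, norm_smul, Real.norm_eq_abs]
    have h1 := profG_scaled (a := ‖x - y‖) (b := ‖x' - y‖) hp (norm_nonneg _) (norm_nonneg _) hr
      ((abs_norm_sub_norm_le _ _).trans (by simp [hrdef]))
    calc _ ≤ _ := mul_le_mul h1 (hM y) (norm_nonneg _) ((abs_nonneg _).trans h1)
      _ = _ := by ring
  refine (norm_integral_le_of_norm_le ((i1.add i2).const_mul _) (Eventually.of_forall hb)).trans ?_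
  apply le_of_eq
  simp only [Pi.add_apply]
  rw [integral_const_mul, integral_add i1 i2, profG_shift_integral hr, profG_shift_integral hr,
    ← hJ, Real.rpow_sub hr, Real.rpow_neg hr.le, Real.rpow_natCast]
  field_simp
  ring

theorem stmt_3 (d : ℕ) (hd : 1 ≤ d) (α : ℝ) (hα : α ∈ Set.Ioo (1 : ℝ) 2)
    (V : EuclideanSpace ℝ (Fin d) → ℝ)
    (hV : ContDiff ℝ 1 V)
    (hL1 : Integrable (fun y => Real.exp (-(V y)) * ‖gradient V y‖))
    (hCb : Continuous (fun y => Real.exp (-(V y)) * ‖gradient V y‖) ∧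
      ∃ M : ℝ, ∀ y, Real.exp (-(V y)) * ‖gradient V y‖ ≤ M) :
    ∀ K : Set (EuclideanSpace ℝ (Fin d)), IsCompact K →
      ∃ C : ℝ, 0 < C ∧ ∀ x ∈ K, ∀ y ∈ K,
        ‖fracDrift d α V x - fracDrift d α V y‖ ≤ C * ‖x - y‖ ^ (2 - α) := by
  intro K hK
  obtain ⟨hα1, hα2⟩ := hα
  obtain ⟨-, M, hM⟩ := hCb
  have hd' : (1 : ℝ) ≤ d := by exact_mod_cast hd
  have hgc : Continuous (gradient V) :=
    (InnerProductSpace.toDual ℝ (EuclideanSpace ℝ (Fin d))).symm.continuous.comp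
      (hV.continuous_fderiv one_ne_zero)
  set g : EuclideanSpace ℝ (Fin d) → EuclideanSpace ℝ (Fin d) :=
    fun y => Real.exp (-(V y)) • gradient V y with hgdef
  have hnorm : ∀ y, ‖g y‖ = Real.exp (-(V y)) * ‖gradient V y‖ := fun y => by
    rw [hgdef, norm_smul, Real.norm_of_nonneg (Real.exp_pos _).le]
  have hcont : Continuous g := (Real.continuous_exp.comp hV.continuous.neg).smul hgc
  have hg : Integrable g := by
    refine (integrable_norm_iff hcont.aestronglyMeasurable).1 ?_
    simpa only [hnorm] using hL1
  obtain ⟨A, hA0, hA⟩ := potential_holder hd (p := (d : ℝ) + α - 2) (by linarith) (by linarith)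
    (by linarith) g hg (M := M) (fun y => by rw [hnorm]; exact hM y)
  set I : EuclideanSpace ℝ (Fin d) → EuclideanSpace ℝ (Fin d) :=
    fun x => ∫ y, ‖x - y‖ ^ (-((d : ℝ) + α - 2)) • g y with hI
  have hexp : (d : ℝ) - ((d : ℝ) + α - 2) = 2 - α := by ring
  rw [hexp] at hA
  have hb : ∀ x, fracDrift d α V x = (-(rieszC d α)) • (Real.exp (V x) • I x) := by
    intro x
    simp only [fracDrift, hI, hgdef, smul_smul]
    congr 1
    · ring
    · congr 1; ext1 y; rw [mul_comm]
  have hAI : ∀ x y, ‖I x - I y‖ ≤ A * ‖x - y‖ ^ (2 - α) := hA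
  have hEV : ContDiff ℝ 1 (fun x => Real.exp (V x)) := hV.exp
  obtain ⟨L, hL⟩ := (hEV.locallyLipschitz.locallyLipschitzOn (s := K)).exists_lipschitzOnWith_of_compact hK
  obtain ⟨E, hE⟩ := hK.exists_bound_of_continuousOn hEV.continuous.continuousOn
  obtain ⟨R, hR⟩ := hK.isBounded.exists_norm_le
  have hRR : ∀ x ∈ K, ∀ y ∈ K, ‖x - y‖ ≤ 2 * |R| := fun x hx y hy => by
    have := norm_sub_le x y
    have := hR x hx
    have := hR y hy
    have := le_abs_self R
    linarith
  have hs : 0 < 2 - α := by linarith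
  set B := ‖I 0‖ + A * |R| ^ (2 - α) with hB
  have hB0 : 0 ≤ B := by positivity
  have hIB : ∀ x ∈ K, ‖I x‖ ≤ B := fun x hx => by
    have h1 := hAI x 0
    rw [sub_zero] at h1
    have h2 : ‖x‖ ^ (2 - α) ≤ |R| ^ (2 - α) :=
      Real.rpow_le_rpow (norm_nonneg _) ((hR x hx).trans (le_abs_self R)) hs.le
    have h3 := mul_le_mul_of_nonneg_left h2 hA0
    have h4 := norm_le_norm_add_norm_sub' (I x) (I 0)
    linarith
  set D := (2 * |R|) ^ (α - 1) with hD
  have hD0 : 0 ≤ D := by positivity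
  have hlin : ∀ x ∈ K, ∀ y ∈ K, ‖x - y‖ ≤ D * ‖x - y‖ ^ (2 - α) := fun x hx y hy => by
    rcases (norm_nonneg (x - y)).eq_or_lt with h | h
    · rw [← h]; positivity
    · calc ‖x - y‖ = ‖x - y‖ ^ (α - 1) * ‖x - y‖ ^ (2 - α) := by
            rw [← Real.rpow_add h]; norm_num
        _ ≤ _ := by
            gcongr
            exact Real.rpow_le_rpow (norm_nonneg _) (hRR x hx y hy) (by linarith)
  refine ⟨|rieszC d α| * (|E| * A + L * D * B) + 1, by positivity, fun x hx y hy => ?_⟩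
  have hq : 0 ≤ ‖x - y‖ ^ (2 - α) := by positivity
  rw [hb, hb, ← smul_sub, norm_smul, norm_neg, Real.norm_eq_abs]
  have hdec : Real.exp (V x) • I x - Real.exp (V y) • I y =
      Real.exp (V x) • (I x - I y) + (Real.exp (V x) - Real.exp (V y)) • I y := by
    rw [smul_sub, sub_smul]; abel
  have t1 : ‖Real.exp (V x) • (I x - I y)‖ ≤ |E| * (A * ‖x - y‖ ^ (2 - α)) := by
    rw [norm_smul]
    exact mul_le_mul ((hE x hx).trans (le_abs_self E)) (hAI x y) (norm_nonneg _) (abs_nonneg _)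
  have t2 : ‖(Real.exp (V x) - Real.exp (V y)) • I y‖ ≤ (L * (D * ‖x - y‖ ^ (2 - α))) * B := by
    rw [norm_smul]
    refine mul_le_mul ?_ (hIB y hy) (norm_nonneg _) (by positivity)
    refine (lipschitzOnWith_iff_norm_sub_le.1 hL hx hy).trans ?_
    exact mul_le_mul_of_nonneg_left (hlin x hx y hy) L.2
  have t3 : ‖Real.exp (V x) • I x - Real.exp (V y) • I y‖ ≤
      (|E| * A + L * D * B) * ‖x - y‖ ^ (2 - α) := by
    rw [hdec]
    refine (norm_add_le _ _).trans ((add_le_add t1 t2).trans (le_of_eq ?_))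
    ring
  have t4 := mul_le_mul_of_nonneg_left t3 (abs_nonneg (rieszC d α))
  nlinarith
end

section
/- Let d ≥ 2 be an integer and α ∈ (0,1) (so that d > 2−α). Let V ∈ C¹(ℝ^d) be such that e^{−V}|∇V| ∈ L¹(ℝ^d; dx) ∩ C_b(ℝ^d). Then the fractional drift b is continuously differentiable on ℝ^d, i.e., b ∈ C¹(ℝ^d; ℝ^d). -/
open MeasureTheory Real Filter
open scoped RealInnerProductSpace

open Topology

noncomputable def psiK (p ε t : ℝ) : ℝ :=
  ε ^ (-p) + ∫ u in ε..t, (-p) * (max u ε) ^ (-p - 1)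

lemma psiK_cont {p ε : ℝ} (hε : 0 < ε) : Continuous fun u : ℝ => (-p) * (max u ε) ^ (-p - 1) := by
  refine continuous_const.mul (Continuous.rpow_const (by fun_prop) fun u => Or.inl ?_)
  exact (lt_of_lt_of_le hε (le_max_right _ _)).ne'

lemma psiK_hasDerivAt {p ε : ℝ} (hε : 0 < ε) (t : ℝ) :
    HasDerivAt (psiK p ε) ((-p) * (max t ε) ^ (-p - 1)) t :=
  ((psiK_cont hε).integral_hasStrictDerivAt ε t).hasDerivAt.const_add _

lemma psiK_of_ge {p ε t : ℝ} (hp : 0 < p) (hε : 0 < ε) (ht : ε ≤ t) : psiK p ε t = t ^ (-p) := by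
  have h1 : ∫ u in ε..t, (-p) * (max u ε) ^ (-p - 1) = ∫ u in ε..t, (-p) * u ^ (-p - 1) := by
    apply intervalIntegral.integral_congr
    intro u hu
    rw [Set.uIcc_of_le ht] at hu
    simp only [max_eq_left hu.1]
  rw [psiK, h1, intervalIntegral.integral_const_mul, integral_rpow]
  · rw [sub_add_cancel]
    field_simp
    ring
  · right
    refine ⟨by linarith, ?_⟩
    rw [Set.uIcc_of_le ht]
    intro h
    linarith [h.1]

lemma psiK_of_le {p ε t : ℝ} (hε : 0 < ε) (ht : t ≤ ε) :
    psiK p ε t = ε ^ (-p) + p * ε ^ (-p - 1) * (ε - t) := by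
  have h1 : ∫ u in ε..t, (-p) * (max u ε) ^ (-p - 1) = ∫ u in ε..t, (-p) * ε ^ (-p - 1) := by
    apply intervalIntegral.integral_congr
    intro u hu
    rw [Set.uIcc_of_ge ht] at hu
    simp only [max_eq_right hu.2]
  rw [psiK, h1, intervalIntegral.integral_const, smul_eq_mul]
  ring

lemma psiK_bound1 {p ε t : ℝ} (hp : 0 < p) (hε : 0 < ε) (ht : 0 ≤ t) :
    |psiK p ε t| ≤ (1 + p) * ε ^ (-p) := by
  have h0 : 0 < ε ^ (-p) := rpow_pos_of_pos hε _
  rcases le_total ε t with h | h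
  · rw [psiK_of_ge hp hε h, abs_of_nonneg (rpow_nonneg ht _)]
    have := rpow_le_rpow_of_nonpos hε h (by linarith : -p ≤ 0)
    nlinarith
  · rw [psiK_of_le hε h, abs_of_nonneg (by
      have := sub_nonneg.2 h
      positivity)]
    have h2 : ε ^ (-p) = ε ^ (-p - 1) * ε := by
      rw [← rpow_add_one hε.ne']; congr 1; ring
    have h3 : 0 < ε ^ (-p - 1) := rpow_pos_of_pos hε _
    have h4 : ε ^ (-p - 1) * (ε - t) ≤ ε ^ (-p) := by rw [h2]; gcongr; linarith
    nlinarith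

lemma psiK_bound2 {p ε t : ℝ} (hp : 0 < p) (hε : 0 < ε) (ht : 0 < t) :
    |psiK p ε t| ≤ (1 + p) * t ^ (-p) := by
  rcases le_total ε t with h | h
  · rw [psiK_of_ge hp hε h, abs_of_nonneg (rpow_nonneg ht.le _)]
    have : 0 < t ^ (-p) := rpow_pos_of_pos ht _
    nlinarith
  · refine (psiK_bound1 hp hε ht.le).trans ?_
    have := rpow_le_rpow_of_nonpos ht h (by linarith : -p ≤ 0)
    gcongr

section kern
variable {E : Type*} [NormedAddCommGroup E] [InnerProductSpace ℝ E]

noncomputable def dKer (p ε : ℝ) (z : E) : E →L[ℝ] ℝ :=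
  (2 * (-p) * (max (‖z‖ ^ 2) ε) ^ (-p - 1)) • innerSL ℝ z

lemma dKer_norm {p ε : ℝ} (hp : 0 < p) (z : E) :
    ‖dKer p ε z‖ = 2 * p * (max (‖z‖ ^ 2) ε) ^ (-p - 1) * ‖z‖ := by
  have h : 0 ≤ max (‖z‖ ^ 2) ε := le_max_of_le_left (by positivity)
  have h2 := rpow_nonneg h (-p - 1)
  rw [dKer, norm_smul, innerSL_apply_norm, Real.norm_eq_abs, abs_mul, abs_of_nonneg h2, abs_mul,
    abs_neg, abs_of_pos hp, abs_of_pos (by norm_num : (0:ℝ) < 2)]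

lemma sq_rpow_norm (z : E) (r : ℝ) : (‖z‖ ^ 2) ^ r = ‖z‖ ^ (2 * r) := by
  rw [rpow_mul (norm_nonneg z)]; norm_cast

lemma dKer_bound {p ε : ℝ} (hp : 0 < p) (z : E) :
    ‖dKer p ε z‖ ≤ 2 * p * ‖z‖ ^ (-(2 * p + 1)) := by
  rw [dKer_norm hp]
  by_cases hz : z = 0
  · subst hz
    simp only [norm_zero, mul_zero]
    positivity
  · have hz' : 0 < ‖z‖ := norm_pos_iff.2 hz
    have h1 : (max (‖z‖ ^ 2) ε) ^ (-p - 1) ≤ (‖z‖ ^ 2) ^ (-p - 1) :=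
      rpow_le_rpow_of_nonpos (by positivity) (le_max_left _ _) (by linarith)
    have h2 : ‖z‖ ^ (-(2 * p + 1)) = (‖z‖ ^ 2) ^ (-p - 1) * ‖z‖ := by
      rw [sq_rpow_norm, ← rpow_add_one hz'.ne']; congr 1; ring
    rw [h2, mul_assoc]
    gcongr

lemma dKer_bound_const {p ε : ℝ} (hp : 0 < p) (hε : 0 < ε) (z : E) :
    ‖dKer p ε z‖ ≤ 2 * p * ε ^ (-p - 1 / 2) := by
  rw [dKer_norm hp]
  set m := max (‖z‖ ^ 2) ε with hm
  have hm0 : 0 < m := lt_of_lt_of_le hε (le_max_right _ _)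
  have h1 : ‖z‖ ≤ m ^ (1 / 2 : ℝ) := by
    rw [← Real.sqrt_eq_rpow]
    exact Real.le_sqrt_of_sq_le (le_max_left _ _)
  have h2 : m ^ (-p - 1 / 2) ≤ ε ^ (-p - 1 / 2) :=
    rpow_le_rpow_of_nonpos hε (le_max_right _ _) (by linarith)
  have h3 : m ^ (-p - 1 / 2) = m ^ (-p - 1) * m ^ (1 / 2 : ℝ) := by
    rw [← rpow_add hm0]; congr 1; ring
  calc 2 * p * m ^ (-p - 1) * ‖z‖ ≤ 2 * p * m ^ (-p - 1) * m ^ (1 / 2 : ℝ) := by gcongr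
    _ = 2 * p * m ^ (-p - 1 / 2) := by rw [h3]; ring
    _ ≤ _ := by gcongr

lemma dKer_cont {p ε : ℝ} (hε : 0 < ε) : Continuous (dKer p ε : E → E →L[ℝ] ℝ) := by
  unfold dKer
  refine Continuous.smul (continuous_const.mul (Continuous.rpow_const (by fun_prop)
    fun u => Or.inl ?_)) (innerSL ℝ).continuous
  exact (lt_of_lt_of_le hε (le_max_right _ _)).ne'

lemma dKer_meas [MeasurableSpace E] [BorelSpace E] [FiniteDimensional ℝ E] {p ε : ℝ} :
    StronglyMeasurable (dKer p ε : E → E →L[ℝ] ℝ) := by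
  unfold dKer
  have h : Measurable fun z : E => 2 * (-p) * (max (‖z‖ ^ 2) ε) ^ (-p - 1) := by fun_prop
  refine StronglyMeasurable.smul h.stronglyMeasurable ?_
  exact (innerSL ℝ).continuous.stronglyMeasurable

lemma dKer_eq {p ε : ℝ} {z : E} (hε : 0 ≤ ε) (h : ε ≤ ‖z‖ ^ 2) : dKer p ε z = dKer p 0 z := by
  unfold dKer
  rw [max_eq_left h, max_eq_left (hε.trans h)]

lemma psiK_hasFDerivAt {p ε : ℝ} (hε : 0 < ε) (z : E) :
    HasFDerivAt (fun z : E => psiK p ε (‖z‖ ^ 2)) (dKer p ε z) z := by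
  have h := (psiK_hasDerivAt (p := p) hε (‖z‖ ^ 2)).comp_hasFDerivAt z
    (hasStrictFDerivAt_norm_sq z).hasFDerivAt
  refine h.congr_fderiv ?_
  unfold dKer
  ext w
  simp
  ring

lemma psiK_contin {p ε : ℝ} (hε : 0 < ε) : Continuous (fun z : E => psiK p ε (‖z‖ ^ 2)) :=
  continuous_iff_continuousAt.2 fun z => (psiK_hasFDerivAt hε z).continuousAt

end kern

section main
variable {E : Type*} [NormedAddCommGroup E] [InnerProductSpace ℝ E] [FiniteDimensional ℝ E]
  [MeasurableSpace E] [BorelSpace E]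

lemma ker_ball (hd : 1 ≤ Module.finrank ℝ E) {q : ℝ} (hq : q < Module.finrank ℝ E) :
    Integrable ((Metric.ball (0 : E) 1).indicator fun z => ‖z‖ ^ (-q)) := by
  rw [integrable_indicator_iff measurableSet_ball]
  refine integrableOn_ball_of_norm_le_rpow (C := 1) (α := q) hd hq (ae_of_all _ fun z => ?_)
    (Measurable.aestronglyMeasurable (by fun_prop))
  rw [Real.norm_of_nonneg (rpow_nonneg (norm_nonneg _) _), one_mul]

lemma ker_int (hd : 1 ≤ Module.finrank ℝ E) {q : ℝ} (hq0 : 0 ≤ q) (hq : q < Module.finrank ℝ E)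
    {g : E → E} (hg : Integrable g) {M : ℝ} (hM : ∀ y, ‖g y‖ ≤ M) (x : E) :
    Integrable fun y => ‖x - y‖ ^ (-q) * ‖g y‖ := by
  have h1 := (((ker_ball hd hq).comp_sub_left x).const_mul M).add hg.norm
  refine h1.mono' ((Measurable.aestronglyMeasurable (by fun_prop)).mul hg.norm.1)
    (ae_of_all _ fun y => ?_)
  have h0 : 0 ≤ ‖x - y‖ ^ (-q) := rpow_nonneg (norm_nonneg _) _
  rw [Real.norm_of_nonneg (by positivity)]
  simp only [Pi.add_apply, Set.indicator, Metric.mem_ball, dist_zero_right]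
  have := hM y
  have h2 := norm_nonneg (g y)
  split_ifs with h
  · nlinarith
  · have : ‖x - y‖ ^ (-q) ≤ 1 := rpow_le_one_of_one_le_of_nonpos (not_lt.1 h) (by linarith)
    nlinarith

theorem riesz_contDiff (hd : 1 ≤ Module.finrank ℝ E) {p : ℝ} (hp : 0 < p)
    (hpd : 2 * p + 1 < Module.finrank ℝ E)
    {g : E → E} (hg : Integrable g) {M : ℝ} (hM : ∀ y, ‖g y‖ ≤ M) :
    ContDiff ℝ 1 fun x => ∫ y, ((‖x - y‖ ^ 2) ^ (-p)) • g y := by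
  haveI : Nontrivial E := Module.finrank_pos_iff.1 (by omega : 0 < Module.finrank ℝ E)
  have hM0 : 0 ≤ M := (norm_nonneg _).trans (hM 0)
  -- sequence
  let e : ℕ → ℝ := fun n => 1 / ((n : ℝ) + 1)
  have he : ∀ n, 0 < e n := fun n => by positivity
  have he1 : ∀ n, e n ≤ 1 := fun n => by
    rw [div_le_one (by positivity)]; linarith [n.cast_nonneg (α := ℝ)]
  have het : Tendsto e atTop (𝓝 0) := tendsto_one_div_add_atTop_nhds_zero_nat
  have hev : ∀ z : E, z ≠ 0 → ∀ᶠ n in atTop, e n ≤ ‖z‖ ^ 2 := fun z hz =>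
    (het.eventually_lt_const (by positivity : 0 < ‖z‖ ^ 2)).mono fun n h => h.le
  have hxne : ∀ x : E, ∀ᵐ y : E, y ≠ x := fun x => by
    simp [ae_iff]
  let G : ℝ → E → E →L[ℝ] E := fun ε x => ∫ y, (dKer p ε (x - y)).smulRight (g y)
  have hmeas : ∀ (ε : ℝ) (x : E),
      AEStronglyMeasurable (fun y => (dKer p ε (x - y)).smulRight (g y)) := fun ε x => by
    have h1 : AEStronglyMeasurable (fun y : E => dKer p ε (x - y)) :=
      (dKer_meas.comp_measurable (measurable_const.sub measurable_id)).aestronglyMeasurable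
    exact (ContinuousLinearMap.smulRightL ℝ E E).aestronglyMeasurable_comp₂ h1 hg.1
  have hint : ∀ (ε : ℝ) (x : E), Integrable (fun y => (dKer p ε (x - y)).smulRight (g y)) :=
    fun ε x => by
      refine ((ker_int hd (by positivity) hpd hg hM x).const_mul (2 * p)).mono' (hmeas ε x)
        (ae_of_all _ fun y => ?_)
      rw [ContinuousLinearMap.norm_smulRight_apply, ← mul_assoc]
      gcongr
      exact dKer_bound hp _
  have hbd : ∀ n x y, ‖(dKer p (e n) (x - y)).smulRight (g y)‖
      ≤ 2 * p * (e n) ^ (-p - 1 / 2) * ‖g y‖ := fun n x y => by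
    rw [ContinuousLinearMap.norm_smulRight_apply]
    gcongr
    exact dKer_bound_const hp (he n) _
  have hFm : ∀ n x, AEStronglyMeasurable (fun y => psiK p (e n) (‖x - y‖ ^ 2) • g y) :=
    fun n x => (((psiK_contin (he n)).comp (continuous_const.sub continuous_id)
      ).aestronglyMeasurable).smul hg.1
  have hder : ∀ n x, HasFDerivAt (fun x => ∫ y, psiK p (e n) (‖x - y‖ ^ 2) • g y) (G (e n) x) x := by
    intro n x
    refine hasFDerivAt_integral_of_dominated_of_fderiv_le (s := Set.univ)
      (F' := fun x y => (dKer p (e n) (x - y)).smulRight (g y)) univ_mem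
      (Eventually.of_forall (hFm n)) ?_ (hmeas _ _) (ae_of_all _ fun y x _ => hbd n x y)
      (hg.norm.const_mul _) (ae_of_all _ fun y x _ => ?_)
    · refine (hg.norm.const_mul ((1 + p) * (e n) ^ (-p))).mono' (hFm n x) (ae_of_all _ fun y => ?_)
      rw [norm_smul]
      gcongr
      exact psiK_bound1 hp (he n) (by positivity)
    · have h := (psiK_hasFDerivAt (p := p) (he n) (x - y)).comp x ((hasFDerivAt_id x).sub_const y)
      exact (h.smul_const (g y))
  have hGc : ∀ n, Continuous (G (e n)) := fun n => by
    refine continuous_of_dominated (hmeas _) (fun x => ae_of_all _ (hbd n x))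
      (hg.norm.const_mul _) (ae_of_all _ fun y => ?_)
    exact ((ContinuousLinearMap.smulRightL ℝ E E).flip (g y)).continuous.comp
      ((dKer_cont (he n)).comp (continuous_id.sub continuous_const))
  -- pointwise convergence
  have hpt : ∀ x, Tendsto (fun n => ∫ y, psiK p (e n) (‖x - y‖ ^ 2) • g y) atTop
      (𝓝 (∫ y, ((‖x - y‖ ^ 2) ^ (-p)) • g y)) := fun x => by
    refine tendsto_integral_of_dominated_convergence
      (fun y => (1 + p) * (‖x - y‖ ^ (-(2 * p)) * ‖g y‖)) (hFm · x)
      ((ker_int hd (by positivity) (by linarith) hg hM x).const_mul _) (fun n => ?_) ?_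
    · filter_upwards [hxne x] with y hy
      have hz : 0 < ‖x - y‖ := norm_pos_iff.2 (sub_ne_zero.2 hy.symm)
      rw [norm_smul, ← mul_assoc]
      gcongr
      have := psiK_bound2 hp (he n) (by positivity : 0 < ‖x - y‖ ^ 2)
      rwa [sq_rpow_norm, mul_neg] at this
    · filter_upwards [hxne x] with y hy
      refine tendsto_const_nhds.congr' ?_
      filter_upwards [hev (x - y) (sub_ne_zero.2 hy.symm)] with n hn
      rw [psiK_of_ge hp (he n) hn]
  -- uniform convergence
  let w : ℕ → E → ℝ := fun n z => ‖dKer p 0 z - dKer p (e n) z‖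
  have hwm : ∀ n, AEStronglyMeasurable (w n) := fun n =>
    (dKer_meas.sub dKer_meas).norm.aestronglyMeasurable
  have hwb : ∀ n z, w n z ≤ 4 * p * (Metric.ball (0 : E) 1).indicator
      (fun z => ‖z‖ ^ (-(2 * p + 1))) z := fun n z => by
    simp only [Set.indicator, Metric.mem_ball, dist_zero_right]
    split_ifs with h
    · refine (norm_sub_le _ _).trans ?_
      have h1 := dKer_bound (ε := 0) hp z
      have h2 := dKer_bound (ε := e n) hp z
      linarith
    · have : dKer p (e n) z = dKer p 0 z := dKer_eq (he n).le (by
        have := he1 n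
        nlinarith [not_lt.1 h])
      simp [w, this]
  have hwi : ∀ n, Integrable (w n) := fun n =>
    ((ker_ball hd hpd).const_mul (4 * p)).mono' (hwm n) (ae_of_all _ fun z => by
      rw [Real.norm_of_nonneg (norm_nonneg _)]; exact hwb n z)
  have hwt : Tendsto (fun n => ∫ z, w n z) atTop (𝓝 0) := by
    have := tendsto_integral_of_dominated_convergence (μ := (volume : Measure E))
      (F := w) (f := fun _ => (0 : ℝ)) _ hwm
      ((ker_ball hd hpd).const_mul (4 * p)) (fun n => ae_of_all _ fun z => by
        rw [Real.norm_of_nonneg (norm_nonneg _)]; exact hwb n z) (by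
        filter_upwards [hxne 0] with z hz
        refine tendsto_const_nhds.congr' ?_
        filter_upwards [hev z hz] with n hn
        simp [w, dKer_eq (he n).le hn])
    simpa using this
  have hGb : ∀ n x, ‖G 0 x - G (e n) x‖ ≤ (∫ z, w n z) * M := fun n x => by
    have h1 : G 0 x - G (e n) x = ∫ y, ((dKer p 0 (x - y)).smulRight (g y)
        - (dKer p (e n) (x - y)).smulRight (g y)) := (integral_sub (hint _ _) (hint _ _)).symm
    rw [h1, ← integral_sub_left_eq_self (w n) volume x, ← integral_mul_const]
    refine norm_integral_le_of_norm_le (((hwi n).comp_sub_left x).mul_const M)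
      (ae_of_all _ fun y => ?_)
    have h2 : (dKer p 0 (x - y)).smulRight (g y) - (dKer p (e n) (x - y)).smulRight (g y)
        = (dKer p 0 (x - y) - dKer p (e n) (x - y)).smulRight (g y) := by
      ext v; simp [sub_smul]
    rw [h2, ContinuousLinearMap.norm_smulRight_apply]
    exact mul_le_mul_of_nonneg_left (hM y) (norm_nonneg _)
  have hunif : TendstoUniformly (fun n => G (e n)) (G 0) atTop := by
    rw [Metric.tendstoUniformly_iff]
    intro δ hδ
    have : Tendsto (fun n => (∫ z, w n z) * M) atTop (𝓝 0) := by simpa using hwt.mul_const M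
    filter_upwards [this.eventually_lt_const hδ] with n hn x
    rw [dist_eq_norm]
    exact (hGb n x).trans_lt hn
  refine contDiff_one_iff_hasFDerivAt.2 ⟨G 0, hunif.continuous (Frequently.of_forall hGc), ?_⟩
  exact hasFDerivAt_of_tendstoUniformly hunif hder hpt

end main

theorem stmt_4 (d : ℕ) (hd : 2 ≤ d) (α : ℝ) (hα : α ∈ Set.Ioo (0 : ℝ) 1)
    (V : EuclideanSpace ℝ (Fin d) → ℝ)
    (hV : ContDiff ℝ 1 V)
    (hL1 : Integrable (fun y => Real.exp (-(V y)) * ‖gradient V y‖))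
    (hCb : Continuous (fun y => Real.exp (-(V y)) * ‖gradient V y‖) ∧
      ∃ M : ℝ, ∀ y, Real.exp (-(V y)) * ‖gradient V y‖ ≤ M) :
    ContDiff ℝ 1 (fracDrift d α V) := by
  obtain ⟨hα0, hα1⟩ := hα
  obtain ⟨-, M, hM⟩ := hCb
  have hd' : (2 : ℝ) ≤ d := by exact_mod_cast hd
  have hgrad : Continuous (gradient V) := by
    unfold gradient
    exact (InnerProductSpace.toDual ℝ _).symm.continuous.comp (hV.continuous_fderiv one_ne_zero)
  have hn : ∀ y, ‖Real.exp (-(V y)) • gradient V y‖ = Real.exp (-(V y)) * ‖gradient V y‖ :=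
    fun y => by rw [norm_smul, Real.norm_of_nonneg (Real.exp_pos _).le]
  have hVc := hV.continuous
  have hgc : Continuous fun y => Real.exp (-(V y)) • gradient V y := by fun_prop
  have hg : Integrable fun y => Real.exp (-(V y)) • gradient V y := by
    rw [← integrable_norm_iff hgc.aestronglyMeasurable]
    simpa only [hn] using hL1
  have key := riesz_contDiff (E := EuclideanSpace ℝ (Fin d)) (by simp; omega)
    (p := ((d : ℝ) + α - 2) / 2) (by linarith) (by simp; linarith) hg (M := M)
    (fun y => by rw [hn]; exact hM y)
  have heq : (fun x : EuclideanSpace ℝ (Fin d) => ∫ y,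
      (Real.exp (-(V y)) * ‖x - y‖ ^ (-((d : ℝ) + α - 2))) • gradient V y) =
      fun x => ∫ y, ((‖x - y‖ ^ 2) ^ (-(((d : ℝ) + α - 2) / 2))) •
        (Real.exp (-(V y)) • gradient V y) := by
    funext x
    congr 1
    funext y
    rw [sq_rpow_norm, smul_smul, mul_comm]
    congr 3
    ring
  rw [← heq] at key
  unfold fracDrift
  exact ((contDiff_const.mul hV.exp).neg).smul key
end

section
/- Let d ≥ 1 be an integer and α ∈ (0,2) with d > 2−α. Let V be a radial function on ℝ^d (write V(x) = V(|x|)) with V ∈ C¹(ℝ^d) and e^{−V}|∇V| ∈ L¹(ℝ^d; dx) ∩ C_b(ℝ^d). Suppose that r₀ := sup{r > 0 : V'(r) ≤ 0} < ∞, that ∫₀^∞ e^{−V(r)} |V'(r)| r^d dr < ∞, and that ∫₀^∞ e^{−V(r)} V'(r) r^d dr > 0. Then there exist constants c₁, c₂ > 0 and r₁ ≥ 1 such that for all x ∈ ℝ^d: ⟨x, b(x)⟩ ≤ c₁ if |x| ≤ r₁, and ⟨x, b(x)⟩ ≤ −c₂ e^{V(|x|)} (1+|x|)^{−(d+α)}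 |x|² if |x| > r₁. -/
open MeasureTheory Real Filter
open scoped RealInnerProductSpace

lemma grad_radial {d : ℕ} (V : EuclideanSpace ℝ (Fin d) → ℝ) (v : ℝ → ℝ)
    (hrad : ∀ x, V x = v ‖x‖) (hV : Differentiable ℝ V) (y : EuclideanSpace ℝ (Fin d)) :
    gradient V y = (deriv v ‖y‖ / ‖y‖) • y := by
  by_cases hy : y = 0
  · subst hy
    have h1 : HasFDerivAt V (fderiv ℝ V 0) 0 := (hV 0).hasFDerivAt
    have h2 : HasFDerivAt (fun z => V (-z)) ((fderiv ℝ V 0).comp (-ContinuousLinearMap.id ℝ _)) 0 := by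
      have h1' : HasFDerivAt V (fderiv ℝ V 0) (-(0 : EuclideanSpace ℝ (Fin d))) := by simpa using h1
      exact h1'.comp 0 (hasFDerivAt_id _).neg
    have h3 : (fun z => V (-z)) = V := by
      funext z; rw [hrad, hrad, norm_neg]
    rw [h3] at h2
    have h4 := h1.unique h2
    have h5 : fderiv ℝ V 0 = 0 := by
      ext z
      have := congrArg (fun L => L z) h4
      simp at this
      simp; linarith
    simp [gradient, h5]
  · have hn : 0 < ‖y‖ := norm_pos_iff.2 hy
    have hline : HasDerivAt (fun r : ℝ => V ((r / ‖y‖) • y)) (fderiv ℝ V y ((1 / ‖y‖) • y)) ‖y‖ := by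
      have h1 : HasDerivAt (fun r : ℝ => (r / ‖y‖) • y) ((1 / ‖y‖) • y) ‖y‖ :=
        ((hasDerivAt_id _).div_const _).smul_const y
      have h2 : HasFDerivAt V (fderiv ℝ V y) ((‖y‖ / ‖y‖) • y) := by
        rw [div_self hn.ne', one_smul]; exact (hV y).hasFDerivAt
      exact h2.comp_hasDerivAt _ h1
    have hv : HasDerivAt v (fderiv ℝ V y ((1 / ‖y‖) • y)) ‖y‖ := by
      refine hline.congr_of_eventuallyEq ?_
      filter_upwards [lt_mem_nhds hn] with r hr
      rw [hrad, norm_smul, norm_div, norm_norm, div_mul_cancel₀ _ hn.ne', Real.norm_of_nonneg hr.le]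
    have hv' : HasDerivAt v (deriv v ‖y‖) ‖y‖ := hv.differentiableAt.hasDerivAt
    have hnorm : HasFDerivAt (fun z : EuclideanSpace ℝ (Fin d) => ‖z‖) ((1 / ‖y‖) • innerSL ℝ y) y := by
      have h1 := (hasStrictFDerivAt_norm_sq y).hasFDerivAt
      have h2 := h1.sqrt (by positivity)
      simp only [Real.sqrt_sq (norm_nonneg _)] at h2
      refine h2.congr_fderiv ?_
      ext z
      simp only [ContinuousLinearMap.smul_apply, smul_eq_mul, nsmul_eq_mul]
      push_cast
      field_simp
    have hc := hv'.comp_hasFDerivAt y hnorm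
    have hVe : V = v ∘ (fun z => ‖z‖) := by funext z; simp [hrad]
    rw [← hVe] at hc
    have hg : HasGradientAt V ((deriv v ‖y‖ / ‖y‖) • y) y := by
      rw [hasGradientAt_iff_hasFDerivAt]
      refine hc.congr_fderiv ?_
      ext z
      simp only [ContinuousLinearMap.smul_apply, smul_eq_mul, InnerProductSpace.toDual_apply_apply,
        innerSL_apply_apply, real_inner_smul_left]
      ring
    exact hg.gradient

lemma kernel_integrable (d : ℕ) (hd : 1 ≤ d) (β : ℝ) (hβ : β < d) :
    IntegrableOn (fun z : EuclideanSpace ℝ (Fin d) => ‖z‖ ^ (-β)) (Metric.ball 0 1) := by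
  have : Nonempty (Fin d) := ⟨⟨0, hd⟩⟩
  rw [integrableOn_fun_norm_addHaar volume (f := fun r => r ^ (-β))]
  simp only [finrank_euclideanSpace, Fintype.card_fin, smul_eq_mul]
  have h : IntegrableOn (fun r : ℝ => r ^ ((d : ℝ) - 1 - β)) (Set.Ioo 0 1) := by
    rw [intervalIntegral.integrableOn_Ioo_rpow_iff one_pos]
    linarith
  refine h.congr_fun (fun r hr => ?_) measurableSet_Ioo
  have hr : 0 < r := hr.1
  simp only
  rw [← Real.rpow_natCast, ← Real.rpow_add hr]
  congr 1
  push_cast [Nat.cast_sub hd]; ring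

lemma sym_quad {d : ℕ} (F : ℝ → ℝ) (R : ℝ) (x : EuclideanSpace ℝ (Fin d))
    (hi : ∀ w : EuclideanSpace ℝ (Fin d),
      IntegrableOn (fun y => F ‖y‖ * ⟪w, y⟫ ^ 2) (Metric.closedBall 0 R)) :
    (d : ℝ) * ∫ y in Metric.closedBall (0 : EuclideanSpace ℝ (Fin d)) R, F ‖y‖ * ⟪x, y⟫ ^ 2
      = ‖x‖ ^ 2 * ∫ y in Metric.closedBall (0 : EuclideanSpace ℝ (Fin d)) R, F ‖y‖ * ‖y‖ ^ 2 := by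
  have key : ∀ w : EuclideanSpace ℝ (Fin d), ‖x‖ = ‖w‖ →
      ∫ y in Metric.closedBall (0 : EuclideanSpace ℝ (Fin d)) R, F ‖y‖ * ⟪x, y⟫ ^ 2
      = ∫ y in Metric.closedBall (0 : EuclideanSpace ℝ (Fin d)) R, F ‖y‖ * ⟪w, y⟫ ^ 2 := by
    intro w hw
    set T := Submodule.reflection (Submodule.span ℝ {x - w})ᗮ with hT
    have hTx : T x = w := Submodule.reflection_sub hw
    have hmp := T.measurePreserving
    have := hmp.setIntegral_preimage_emb T.toHomeomorph.measurableEmbedding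
      (fun y => F ‖y‖ * ⟪w, y⟫ ^ 2) (Metric.closedBall 0 R)
    rw [← this]
    have hpre : T ⁻¹' (Metric.closedBall 0 R) = Metric.closedBall 0 R := by
      ext z; simp
    rw [hpre]
    congr 1
    funext y
    rw [← hTx, T.inner_map_map, T.norm_map]
  have e : ∀ i : Fin d, ∫ y in Metric.closedBall (0 : EuclideanSpace ℝ (Fin d)) R, F ‖y‖ * ⟪x, y⟫ ^ 2
      = ∫ y in Metric.closedBall (0 : EuclideanSpace ℝ (Fin d)) R,
          F ‖y‖ * ⟪EuclideanSpace.single i ‖x‖, y⟫ ^ 2 := fun i => key _ (by simp)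
  calc _ = ∑ i : Fin d, ∫ y in Metric.closedBall (0 : EuclideanSpace ℝ (Fin d)) R,
          F ‖y‖ * ⟪EuclideanSpace.single i ‖x‖, y⟫ ^ 2 := by
        rw [← Finset.sum_congr rfl (fun i _ => e i)]; simp
    _ = _ := by
      rw [← integral_finsetSum _ (fun i _ => hi _), ← integral_const_mul]
      congr 1
      funext y
      rw [EuclideanSpace.real_norm_sq_eq y, ← Finset.mul_sum]
      simp only [EuclideanSpace.inner_single_left]
      simp [mul_pow, ← Finset.mul_sum]
      ring

lemma phi_est (β ε R : ℝ) (hβ : 0 < β) (hε : 0 < ε) (hR : 0 < R) :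
    ∃ ρ : ℝ, 1 ≤ ρ ∧ R < ρ ∧ ∀ (d : ℕ) (x y : EuclideanSpace ℝ (Fin d)), ρ < ‖x‖ → ‖y‖ ≤ R →
      |⟪x, y⟫ * (‖x - y‖ ^ (-β) - ‖x + y‖ ^ (-β)) - 2 * β * ⟪x, y⟫ ^ 2 * ‖x‖ ^ (-β - 2)|
        ≤ ε * (2 * β * ⟪x, y⟫ ^ 2 * ‖x‖ ^ (-β - 2)) := by
  have hc : ContinuousAt (fun q : ℝ => q ^ (-(β / 2) - 1)) 1 :=
    Real.continuousAt_rpow_const _ _ (Or.inl one_ne_zero)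
  obtain ⟨δ, hδ, hq⟩ := Metric.continuousAt_iff.1 hc ε hε
  refine ⟨max 1 (R + 3 * R / δ), le_max_left _ _, lt_of_lt_of_le (by
    have : 0 < 3 * R / δ := by positivity
    linarith) (le_max_right _ _), ?_⟩
  intro d x y hx hy
  set X := ‖x‖ with hX
  have h1 : 1 < X := lt_of_le_of_lt (le_max_left _ _) hx
  have h2 : R + 3 * R / δ < X := lt_of_le_of_lt (le_max_right _ _) hx
  have h30 : 0 < 3 * R / δ := by positivity
  have h3 : R < X := by linarith
  have h4 : 3 * R < δ * X := by
    have : 3 * R / δ < X := by linarith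
    rw [div_lt_iff₀ hδ] at this; linarith
  set s := X ^ 2 + ‖y‖ ^ 2 with hs
  set t := 2 * ⟪x, y⟫ with ht
  have hy0 := norm_nonneg y
  have hin : |⟪x, y⟫| ≤ X * ‖y‖ := abs_real_inner_le_norm x y
  have htb : |t| ≤ 2 * X * ‖y‖ := by
    rw [ht, abs_mul, abs_two]; linarith
  have hst : |t| < s := by
    have : 0 < (X - ‖y‖) ^ 2 := by
      have : 0 < X - ‖y‖ := by linarith
      positivity
    nlinarith
  have hm : ‖x - y‖ ^ (-β) = (s - t) ^ (-(β / 2)) := by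
    have : s - t = ‖x - y‖ ^ 2 := by rw [norm_sub_sq_real]; ring
    rw [this, ← Real.rpow_natCast, ← Real.rpow_mul (norm_nonneg _)]
    congr 1; push_cast; ring
  have hp : ‖x + y‖ ^ (-β) = (s + t) ^ (-(β / 2)) := by
    have : s + t = ‖x + y‖ ^ 2 := by rw [norm_add_sq_real]; ring
    rw [this, ← Real.rpow_natCast, ← Real.rpow_mul (norm_nonneg _)]
    congr 1; push_cast; ring
  have mvt : ∃ ξ, |ξ| ≤ |t| ∧ (s - t) ^ (-(β / 2)) - (s + t) ^ (-(β / 2))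
      = β * t * (s + ξ) ^ (-(β / 2) - 1) := by
    have gen : ∀ t : ℝ, 0 < t → t < s → ∃ ξ, |ξ| ≤ t ∧ (s - t) ^ (-(β / 2)) - (s + t) ^ (-(β / 2))
      = β * t * (s + ξ) ^ (-(β / 2) - 1) := by
      intro t ht0 hts
      have hd : ∀ z, -t ≤ z → HasDerivAt (fun z => (s + z) ^ (-(β / 2)))
          (1 * (-(β / 2)) * (s + z) ^ (-(β / 2) - 1)) z := fun z hz =>
        ((hasDerivAt_id z).const_add s).rpow_const (Or.inl (by simp; linarith))
      obtain ⟨ξ, hξ, he⟩ := exists_hasDerivAt_eq_slope (fun z => (s + z) ^ (-(β / 2)))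
        (fun z => 1 * (-(β / 2)) * (s + z) ^ (-(β / 2) - 1)) (by linarith : -t < t)
        (fun z hz => (hd z hz.1).continuousAt.continuousWithinAt) (fun z hz => hd z hz.1.le)
      refine ⟨ξ, abs_le.2 ⟨hξ.1.le, hξ.2.le⟩, ?_⟩
      rw [eq_div_iff (by linarith)] at he
      rw [sub_eq_add_neg s t]
      linarith
    rcases lt_trichotomy t 0 with h | h | h
    · obtain ⟨ξ, h5, h6⟩ := gen (-t) (by linarith) (by rwa [abs_of_neg h] at hst)
      refine ⟨ξ, by rwa [abs_of_neg h], ?_⟩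
      rw [sub_neg_eq_add, ← sub_eq_add_neg] at h6
      linarith
    · refine ⟨0, by simp, ?_⟩
      simp [h]
    · obtain ⟨ξ, h5, h6⟩ := gen t h (by rwa [abs_of_pos h] at hst)
      exact ⟨ξ, by rwa [abs_of_pos h], h6⟩
  obtain ⟨ξ, hξ, he⟩ := mvt
  have hX0 : 0 < X := by linarith
  set q := (s + ξ) / X ^ 2 with hqd
  have hsx : s + ξ = X ^ 2 * q := by rw [hqd]; field_simp
  have hspos : 0 < s + ξ := by linarith [neg_abs_le ξ]
  have hq0 : 0 < q := by positivity
  have hq1 : |q - 1| < δ := by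
    have : q - 1 = (‖y‖ ^ 2 + ξ) / X ^ 2 := by rw [hqd, hs]; field_simp; ring
    rw [this, abs_div, abs_of_pos (by positivity : 0 < X ^ 2), div_lt_iff₀ (by positivity)]
    have : |‖y‖ ^ 2 + ξ| ≤ ‖y‖ ^ 2 + |ξ| := by
      refine (abs_add_le _ _).trans ?_
      rw [abs_of_nonneg (by positivity)]
    have h7 : ‖y‖ ^ 2 + |ξ| ≤ 3 * R * X := by nlinarith
    nlinarith
  have hq2 := hq (show dist q 1 < δ by rwa [Real.dist_eq])
  rw [Real.dist_eq, Real.one_rpow] at hq2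
  have hfac : (s + ξ) ^ (-(β / 2) - 1) = X ^ (-β - 2) * q ^ (-(β / 2) - 1) := by
    rw [hsx, Real.mul_rpow (by positivity) hq0.le, ← Real.rpow_natCast, ← Real.rpow_mul hX0.le]
    congr 2; push_cast; ring
  rw [hm, hp, he, hfac]
  have : ⟪x, y⟫ * (β * t * (X ^ (-β - 2) * q ^ (-(β / 2) - 1))) - 2 * β * ⟪x, y⟫ ^ 2 * X ^ (-β - 2)
    = (q ^ (-(β / 2) - 1) - 1) * (2 * β * ⟪x, y⟫ ^ 2 * X ^ (-β - 2)) := by rw [ht]; ring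
  have hnn : 0 ≤ 2 * β * ⟪x, y⟫ ^ 2 * X ^ (-β - 2) := by positivity
  rw [this, abs_mul, abs_of_nonneg hnn]
  exact mul_le_mul_of_nonneg_right hq2.le hnn

theorem stmt_7 (d : ℕ) (hd : 1 ≤ d) (α : ℝ) (hα : α ∈ Set.Ioo (0 : ℝ) 2)
    (hdα : 2 - α < (d : ℝ))
    (V : EuclideanSpace ℝ (Fin d) → ℝ) (v : ℝ → ℝ)
    (hrad : ∀ x, V x = v ‖x‖)
    (hV : ContDiff ℝ 1 V)
    (hL1 : Integrable (fun y => Real.exp (-(V y)) * ‖gradient V y‖))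
    (hCb : Continuous (fun y => Real.exp (-(V y)) * ‖gradient V y‖) ∧
      ∃ M : ℝ, ∀ y, Real.exp (-(V y)) * ‖gradient V y‖ ≤ M)
    (hr0 : BddAbove {r : ℝ | 0 < r ∧ deriv v r ≤ 0})
    (hint : IntegrableOn (fun r => Real.exp (-(v r)) * |deriv v r| * r ^ d) (Set.Ioi 0))
    (hpos : 0 < ∫ r in Set.Ioi (0 : ℝ), Real.exp (-(v r)) * deriv v r * r ^ d) :
    ∃ c₁ c₂ r₁ : ℝ, 0 < c₁ ∧ 0 < c₂ ∧ 1 ≤ r₁ ∧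
      ∀ x : EuclideanSpace ℝ (Fin d),
        (‖x‖ ≤ r₁ → ⟪x, fracDrift d α V x⟫ ≤ c₁) ∧
        (r₁ < ‖x‖ → ⟪x, fracDrift d α V x⟫ ≤
          -c₂ * Real.exp (v ‖x‖) * (1 + ‖x‖) ^ (-((d : ℝ) + α)) * ‖x‖ ^ 2) := by
  have hα0 : 0 < α := hα.1
  have hα2 : α < 2 := hα.2
  set β : ℝ := (d : ℝ) + α - 2 with hβd
  have hβ : 0 < β := by rw [hβd]; linarith
  have hβlt : β < d := by rw [hβd]; linarith
  have hd0 : (0 : ℝ) < d := by exact_mod_cast hd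
  have hne : Nonempty (Fin d) := ⟨⟨0, hd⟩⟩
  have hC : 0 < rieszC d α := by
    unfold rieszC
    have h1 : 0 < Real.Gamma (((d : ℝ) - (2 - α)) / 2) := Real.Gamma_pos_of_pos (by linarith)
    have h2 : 0 < Real.Gamma ((2 - α) / 2) := Real.Gamma_pos_of_pos (by linarith)
    positivity
  have hVd : Differentiable ℝ V := hV.differentiable one_ne_zero
  have hVc : Continuous V := hV.continuous
  have hgrad := grad_radial V v hrad hVd
  have hgc : Continuous (gradient V) := by
    unfold gradient
    exact (LinearIsometryEquiv.continuous _).comp (hV.continuous_fderiv one_ne_zero)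
  obtain ⟨hAc, M, hM⟩ := hCb
  have hM0 : 0 ≤ M := le_trans (by positivity) (hM 0)
  -- the kernel bound
  set g : EuclideanSpace ℝ (Fin d) → ℝ := fun y => Real.exp (-(V y)) * ‖gradient V y‖ with hg
  set k : EuclideanSpace ℝ (Fin d) → ℝ :=
    (Metric.ball (0 : EuclideanSpace ℝ (Fin d)) 1).indicator (fun z => ‖z‖ ^ (-β)) with hk
  have hki : Integrable k := by
    rw [hk, integrable_indicator_iff measurableSet_ball]
    exact kernel_integrable d hd β hβlt
  have hbd : ∀ x y, g y * ‖x - y‖ ^ (-β) ≤ M * k (x - y) + g y := by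
    intro x y
    have hg0 : 0 ≤ g y := by positivity
    by_cases h : x - y ∈ Metric.ball (0 : EuclideanSpace ℝ (Fin d)) 1
    · rw [hk, Set.indicator_of_mem h]
      have : g y * ‖x - y‖ ^ (-β) ≤ M * ‖x - y‖ ^ (-β) :=
        mul_le_mul_of_nonneg_right (hM y) (by positivity)
      linarith
    · rw [hk, Set.indicator_of_notMem h]
      have h1 : 1 ≤ ‖x - y‖ := by simpa using h
      have : ‖x - y‖ ^ (-β) ≤ 1 := Real.rpow_le_one_of_one_le_of_nonpos h1 (by linarith)
      nlinarith
  have hdomi : ∀ x, Integrable (fun y => M * k (x - y) + g y) := fun x =>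
    ((hki.comp_sub_left x).const_mul M).add hL1
  have hdomv : ∀ x, ∫ y, (M * k (x - y) + g y) = M * (∫ z, k z) + ∫ y, g y := by
    intro x
    rw [integral_add ((hki.comp_sub_left x).const_mul M) hL1, integral_const_mul,
      integral_sub_left_eq_self k volume x]
  set B : ℝ := M * (∫ z, k z) + ∫ y, g y with hB
  have hB0 : 0 ≤ B := by
    have h1 : 0 ≤ ∫ z, k z :=
      integral_nonneg (fun z => Set.indicator_nonneg (fun _ _ => by positivity) z)
    have h2 : 0 ≤ ∫ y, g y := integral_nonneg (fun y => by positivity)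
    positivity
  have hnormv : ∀ x y,
      ‖(Real.exp (-(V y)) * ‖x - y‖ ^ (-β)) • gradient V y‖ = g y * ‖x - y‖ ^ (-β) := by
    intro x y
    rw [norm_smul, Real.norm_of_nonneg (by positivity), hg]; ring
  have hmeask : ∀ x : EuclideanSpace ℝ (Fin d), Measurable (fun y => ‖x - y‖ ^ (-β)) := fun x => by
    fun_prop
  have hvi : ∀ x, Integrable (fun y => (Real.exp (-(V y)) * ‖x - y‖ ^ (-β)) • gradient V y) := by
    intro x
    refine (hdomi x).mono' ?_ (Eventually.of_forall fun y => ?_)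
    · exact (((by fun_prop : Continuous (fun y => Real.exp (-(V y)))).measurable.mul
        (hmeask x)).aestronglyMeasurable).smul hgc.aestronglyMeasurable
    · rw [hnormv]; exact hbd x y
  set W : EuclideanSpace ℝ (Fin d) → EuclideanSpace ℝ (Fin d) := fun x =>
    ∫ y, (Real.exp (-(V y)) * ‖x - y‖ ^ (-β)) • gradient V y with hW
  have hWb : ∀ x, ‖W x‖ ≤ B := by
    intro x
    rw [← hdomv x]
    refine norm_integral_le_of_norm_le (hdomi x) (Eventually.of_forall fun y => ?_)
    rw [hnormv]; exact hbd x y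
  have hdrift : ∀ x, ⟪x, fracDrift d α V x⟫ = -(rieszC d α * Real.exp (V x)) * ⟪x, W x⟫ := by
    intro x
    rw [show fracDrift d α V x = (-(rieszC d α * Real.exp (V x))) • W x from rfl,
      real_inner_smul_right]
  -- radial profile
  set F : ℝ → ℝ := fun r => Real.exp (-(v r)) * (deriv v r / r) with hF
  have hFg : ∀ y w, Real.exp (-(V y)) * ⟪w, gradient V y⟫ = F ‖y‖ * ⟪w, y⟫ := by
    intro y w
    rw [hgrad, real_inner_smul_right, hrad, hF]; ring
  have hWI : ∀ x, ⟪x, W x⟫ = ∫ y, F ‖y‖ * ⟪x, y⟫ * ‖x - y‖ ^ (-β) := by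
    intro x
    rw [hW]; simp only
    rw [← integral_inner (hvi x)]
    congr 1; funext y
    rw [real_inner_smul_right, ← hFg]; ring
  have hIi : ∀ x : EuclideanSpace ℝ (Fin d), Integrable (fun y => F ‖y‖ * ⟪x, y⟫ * ‖x - y‖ ^ (-β)) := by
    intro x
    refine ((hvi x).const_inner x).congr (Eventually.of_forall fun y => ?_)
    simp only
    rw [real_inner_smul_right, ← hFg]; ring
  have hIin : ∀ x : EuclideanSpace ℝ (Fin d), Integrable (fun y => F ‖y‖ * ⟪x, y⟫ * ‖x + y‖ ^ (-β)) := by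
    intro x
    refine ((hIi x).comp_neg.neg).congr (Eventually.of_forall fun y => ?_)
    simp
  have hWI2 : ∀ x, 2 * ⟪x, W x⟫ =
      ∫ y, F ‖y‖ * (⟪x, y⟫ * (‖x - y‖ ^ (-β) - ‖x + y‖ ^ (-β))) := by
    intro x
    have h1 : ⟪x, W x⟫ = - ∫ y, F ‖y‖ * ⟪x, y⟫ * ‖x + y‖ ^ (-β) := by
      rw [hWI, ← integral_neg_eq_self, ← integral_neg]
      congr 1; funext y
      simp
    have h2 : 2 * ⟪x, W x⟫ = (∫ y, F ‖y‖ * ⟪x, y⟫ * ‖x - y‖ ^ (-β))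
        - ∫ y, F ‖y‖ * ⟪x, y⟫ * ‖x + y‖ ^ (-β) := by
      rw [← hWI x]; linarith
    rw [h2, ← integral_sub (hIi x) (hIin x)]
    congr 1; funext y; ring
  have hWi2 : ∀ x : EuclideanSpace ℝ (Fin d), Integrable
      (fun y => F ‖y‖ * (⟪x, y⟫ * (‖x - y‖ ^ (-β) - ‖x + y‖ ^ (-β)))) := by
    intro x
    refine ((hIi x).sub (hIin x)).congr (Eventually.of_forall fun y => ?_)
    simp only [Pi.sub_apply]; ring
  -- choose R
  obtain ⟨r₀, hr₀⟩ := hr0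
  have hfi : IntegrableOn (fun r => Real.exp (-(v r)) * deriv v r * r ^ d) (Set.Ioi 0) :=
    Integrable.of_integral_ne_zero hpos.ne'
  have htend := intervalIntegral_tendsto_integral_Ioi 0 hfi tendsto_id
  obtain ⟨R, hRpos, hR1⟩ := ((htend.eventually (lt_mem_nhds hpos)).and
    (eventually_gt_atTop (max r₀ 1))).exists
  simp only [id] at hRpos
  have hRr : r₀ < R := lt_of_le_of_lt (le_max_left _ _) hR1
  have hR0 : 0 < R := lt_of_lt_of_le one_pos ((le_max_right _ _).trans hR1.le)
  have hFpos : ∀ r, R < r → 0 ≤ F r := by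
    intro r hr
    have hr' : 0 < r := hR0.trans hr
    have : 0 < deriv v r := by
      by_contra hcon
      have := hr₀ (show r ∈ {r : ℝ | 0 < r ∧ deriv v r ≤ 0} from ⟨hr', not_lt.1 hcon⟩)
      linarith
    rw [hF]; positivity
  set K : ℝ := ∫ y in Metric.closedBall (0 : EuclideanSpace ℝ (Fin d)) R, F ‖y‖ * ‖y‖ ^ 2 with hK
  have hKpos : 0 < K := by
    have h1 : K = ∫ y : EuclideanSpace ℝ (Fin d),
        (Set.Iic R).indicator (fun r => F r * r ^ 2) ‖y‖ := by
      rw [hK, ← integral_indicator Metric.isClosed_closedBall.measurableSet]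
      congr 1; funext y
      simp [Set.indicator]
    rw [h1, integral_fun_norm_addHaar volume]
    simp only [finrank_euclideanSpace, Fintype.card_fin, smul_eq_mul, nsmul_eq_mul]
    have h2 : ∫ r in Set.Ioi (0 : ℝ), r ^ (d - 1) * (Set.Iic R).indicator (fun r => F r * r ^ 2) r
        = ∫ r in (0 : ℝ)..R, Real.exp (-(v r)) * deriv v r * r ^ d := by
      rw [intervalIntegral.integral_of_le hR0.le, ← Set.Ioi_inter_Iic,
        ← setIntegral_indicator measurableSet_Iic]
      refine setIntegral_congr_fun measurableSet_Ioi fun r hr => ?_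
      have hr : 0 < r := hr
      simp only [Set.indicator]
      split_ifs
      · rw [hF]
        obtain ⟨n, rfl⟩ : ∃ n, d = n + 1 := ⟨d - 1, by omega⟩
        simp only [Nat.add_sub_cancel]
        field_simp
        ring
      · simp
    rw [h2]
    have h3 : 0 < volume.real (Metric.ball (0 : EuclideanSpace ℝ (Fin d)) 1) :=
      ENNReal.toReal_pos (Metric.measure_ball_pos _ _ one_pos).ne' measure_ball_lt_top.ne
    positivity
  have hcomp : IsCompact (Metric.closedBall (0 : EuclideanSpace ℝ (Fin d)) R) :=
    isCompact_closedBall _ _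
  have hquadc : ∀ w : EuclideanSpace ℝ (Fin d), Continuous (fun y => F ‖y‖ * ⟪w, y⟫ ^ 2) := by
    intro w
    have : (fun y => F ‖y‖ * ⟪w, y⟫ ^ 2) =
        fun y => Real.exp (-(V y)) * ⟪w, gradient V y⟫ * ⟪w, y⟫ := by
      funext y; rw [hFg]; ring
    rw [this]; fun_prop
  have hquadi : ∀ w : EuclideanSpace ℝ (Fin d),
      IntegrableOn (fun y => F ‖y‖ * ⟪w, y⟫ ^ 2) (Metric.closedBall 0 R) := fun w =>
    (hquadc w).continuousOn.integrableOn_compact hcomp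
  have hradc : Continuous (fun y : EuclideanSpace ℝ (Fin d) => F ‖y‖ * ‖y‖ ^ 2) := by
    have : (fun y : EuclideanSpace ℝ (Fin d) => F ‖y‖ * ‖y‖ ^ 2) =
        fun y => Real.exp (-(V y)) * ⟪y, gradient V y⟫ := by
      funext y; rw [hFg, real_inner_self_eq_norm_sq]
    rw [this]; fun_prop
  set K' : ℝ := ∫ y in Metric.closedBall (0 : EuclideanSpace ℝ (Fin d)) R, |F ‖y‖ * ‖y‖ ^ 2| with hK'
  have hK'0 : 0 ≤ K' := integral_nonneg fun y => abs_nonneg _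
  set ε : ℝ := K / (2 * d * (K' + 1)) with hε
  have hεpos : 0 < ε := by positivity
  have hεK : ε * K' ≤ K / (2 * d) := by
    rw [hε, div_mul_eq_mul_div, div_le_div_iff₀ (by positivity) (by positivity)]
    have : 0 < K * d := by positivity
    nlinarith
  obtain ⟨ρ, hρ1, hρR, hρ⟩ := phi_est β ε R hβ hεpos hR0
  have hmain : ∀ x, ρ < ‖x‖ → β * K / (2 * d) * ‖x‖ ^ (-β) ≤ ⟪x, W x⟫ := by
    intro x hx
    have hX0 : 0 < ‖x‖ := by linarith
    set P := ‖x‖ ^ (-β - 2) with hP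
    have hP0 : 0 < P := by positivity
    have hPX : P * ‖x‖ ^ 2 = ‖x‖ ^ (-β) := by
      rw [hP, ← Real.rpow_natCast, ← Real.rpow_add hX0]; congr 1; push_cast; ring
    have s1 : ∫ y in Metric.closedBall (0 : EuclideanSpace ℝ (Fin d)) R,
        F ‖y‖ * (⟪x, y⟫ * (‖x - y‖ ^ (-β) - ‖x + y‖ ^ (-β))) ≤ 2 * ⟪x, W x⟫ := by
      rw [hWI2 x, ← integral_indicator Metric.isClosed_closedBall.measurableSet]
      refine integral_mono_ae ((hWi2 x).indicator Metric.isClosed_closedBall.measurableSet)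
        (hWi2 x) ?_
      filter_upwards [Measure.ae_ne volume x, Measure.ae_ne volume (-x)] with y hyx1 hyx2
      by_cases hy : y ∈ Metric.closedBall (0 : EuclideanSpace ℝ (Fin d)) R
      · rw [Set.indicator_of_mem hy]
      rw [Set.indicator_of_notMem hy]
      have hy' : R < ‖y‖ := by simpa using hy
      refine mul_nonneg (hFpos _ hy') ?_
      have hsub : 0 < ‖x - y‖ := norm_pos_iff.2 (sub_ne_zero.2 fun h => hyx1 h.symm)
      have hadd : 0 < ‖x + y‖ := norm_pos_iff.2 fun h =>
        hyx2 (eq_neg_of_add_eq_zero_right h)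
      have e1 := norm_sub_sq_real x y
      have e2 := norm_add_sq_real x y
      rcases le_total 0 ⟪x, y⟫ with h | h
      · refine mul_nonneg h (sub_nonneg.2 ?_)
        refine Real.rpow_le_rpow_of_nonpos hsub ?_ (by linarith)
        exact le_of_sq_le_sq (by linarith) hadd.le
      · refine mul_nonneg_of_nonpos_of_nonpos h (sub_nonpos.2 ?_)
        refine Real.rpow_le_rpow_of_nonpos hadd ?_ (by linarith)
        exact le_of_sq_le_sq (by linarith) hsub.le
    have s2 : ∫ y in Metric.closedBall (0 : EuclideanSpace ℝ (Fin d)) R,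
        (2 * β * P * (F ‖y‖ * ⟪x, y⟫ ^ 2) - 2 * β * P * ε * ‖x‖ ^ 2 * |F ‖y‖ * ‖y‖ ^ 2|) ≤
        ∫ y in Metric.closedBall (0 : EuclideanSpace ℝ (Fin d)) R,
        F ‖y‖ * (⟪x, y⟫ * (‖x - y‖ ^ (-β) - ‖x + y‖ ^ (-β))) := by
      refine setIntegral_mono_on (((hquadi x).const_mul _).sub
        ((hradc.abs.continuousOn.integrableOn_compact hcomp).const_mul _)) (hWi2 x).integrableOn
        Metric.isClosed_closedBall.measurableSet fun y hy => ?_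
      have hy' : ‖y‖ ≤ R := by simpa using hy
      have h1 := hρ d x y hx hy'
      set φ := ⟪x, y⟫ * (‖x - y‖ ^ (-β) - ‖x + y‖ ^ (-β)) with hφ
      have h2 : |F ‖y‖ * (φ - 2 * β * ⟪x, y⟫ ^ 2 * P)| ≤
          |F ‖y‖| * (ε * (2 * β * ⟪x, y⟫ ^ 2 * P)) := by
        rw [abs_mul]; exact mul_le_mul_of_nonneg_left h1 (abs_nonneg _)
      have h3 : ⟪x, y⟫ ^ 2 ≤ ‖x‖ ^ 2 * ‖y‖ ^ 2 := by
        rw [← mul_pow, ← sq_abs]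
        exact pow_le_pow_left₀ (abs_nonneg _) (abs_real_inner_le_norm x y) 2
      have h4 : |F ‖y‖| * (ε * (2 * β * ⟪x, y⟫ ^ 2 * P)) ≤
          2 * β * P * ε * ‖x‖ ^ 2 * |F ‖y‖ * ‖y‖ ^ 2| := by
        rw [abs_mul (F ‖y‖) (‖y‖ ^ 2), abs_of_nonneg (by positivity : 0 ≤ ‖y‖ ^ 2)]
        calc _ = |F ‖y‖| * (ε * (2 * β * P)) * ⟪x, y⟫ ^ 2 := by ring
          _ ≤ |F ‖y‖| * (ε * (2 * β * P)) * (‖x‖ ^ 2 * ‖y‖ ^ 2) := by gcongr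
          _ = _ := by ring
      have h5 := neg_abs_le (F ‖y‖ * (φ - 2 * β * ⟪x, y⟫ ^ 2 * P))
      linarith
    rw [integral_sub ((hquadi x).const_mul _)
        ((hradc.abs.continuousOn.integrableOn_compact hcomp).const_mul _),
      integral_const_mul, integral_const_mul, ← hK'] at s2
    have s3 := sym_quad F R x hquadi
    rw [← hK] at s3
    have s4 : ∫ y in Metric.closedBall (0 : EuclideanSpace ℝ (Fin d)) R, F ‖y‖ * ⟪x, y⟫ ^ 2
        = ‖x‖ ^ 2 * (K / d) := by
      rw [← mul_div_assoc, eq_div_iff hd0.ne']; linarith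
    rw [s4] at s2
    have s5 : 2 * β * (P * ‖x‖ ^ 2) * (K / d) - 2 * β * (P * ‖x‖ ^ 2) * (ε * K')
        ≤ 2 * ⟪x, W x⟫ := by
      linarith
    rw [hPX] at s5
    have s6 : 2 * β * ‖x‖ ^ (-β) * (ε * K') ≤ 2 * β * ‖x‖ ^ (-β) * (K / (2 * d)) := by gcongr
    have s7 : K / d = 2 * (K / (2 * d)) := by field_simp
    rw [s7] at s5
    have s8 : β * K / (2 * d) * ‖x‖ ^ (-β) = β * ‖x‖ ^ (-β) * (K / (2 * d)) := by ring
    rw [s8]; linarith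
  obtain ⟨m, hm⟩ := (isCompact_closedBall (0 : EuclideanSpace ℝ (Fin d)) ρ).bddAbove_image
    hVc.continuousOn
  refine ⟨rieszC d α * Real.exp m * (ρ * B) + 1, rieszC d α * (β * K / (2 * d)), ρ,
    by positivity, by positivity, hρ1, fun x => ⟨fun hx => ?_, fun hx => ?_⟩⟩
  · rw [hdrift]
    have h1 : |⟪x, W x⟫| ≤ ρ * B := (abs_real_inner_le_norm _ _).trans
      (mul_le_mul hx (hWb x) (norm_nonneg _) (by linarith))
    have h2 : V x ≤ m := hm ⟨x, by simpa using hx, rfl⟩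
    have h3 : rieszC d α * Real.exp (V x) * |⟪x, W x⟫| ≤ rieszC d α * Real.exp m * (ρ * B) := by
      gcongr
    have h4 : -(rieszC d α * Real.exp (V x)) * ⟪x, W x⟫ ≤
        rieszC d α * Real.exp (V x) * |⟪x, W x⟫| := by
      have := neg_abs_le ⟪x, W x⟫
      have h5 : 0 < rieszC d α * Real.exp (V x) := by positivity
      nlinarith
    linarith
  · rw [hdrift, hrad x]
    have hX0 : 0 < ‖x‖ := by linarith
    have h1 := hmain x hx
    have h2 : (1 + ‖x‖) ^ (-((d : ℝ) + α)) * ‖x‖ ^ 2 ≤ ‖x‖ ^ (-β) := by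
      have : ‖x‖ ^ (-β) = ‖x‖ ^ (-((d : ℝ) + α)) * ‖x‖ ^ 2 := by
        rw [← Real.rpow_natCast, ← Real.rpow_add hX0]; congr 1; rw [hβd]; push_cast; ring
      rw [this]
      refine mul_le_mul_of_nonneg_right ?_ (by positivity)
      exact Real.rpow_le_rpow_of_nonpos hX0 (by linarith) (by linarith)
    have h3 : rieszC d α * Real.exp (v ‖x‖) * (β * K / (2 * d) *
        ((1 + ‖x‖) ^ (-((d : ℝ) + α)) * ‖x‖ ^ 2)) ≤ rieszC d α * Real.exp (v ‖x‖) * ⟪x, W x⟫ := by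
      refine mul_le_mul_of_nonneg_left (le_trans ?_ h1) (by positivity)
      gcongr
    linarith
end

section
/- Let α ∈ (0,1] and let V ∈ C²(ℝ) be a symmetric function (V(x) = V(−x) for all x ∈ ℝ) such that e^{−V} ∈ L¹(ℝ; dx) ∩ C_b²(ℝ). Suppose that limsup_{|x|→∞} |x|³ e^{−V(x)} |V'(x)² − V''(x)| < ∞, that lim_{x→∞} x e^{−V(x)} = 0, and that liminf_{x→∞} x³ e^{−V(x)} (V'(x)² − V''(x)) ≥ 0. Then there exist constants c > 0 and R > 0 such that for all x ≥ R: −(−Δ)^{α/2} e^{−V(x)} ≥ c x^{−(1+α)}. -/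
open MeasureTheory Real Filter

/-- The constant `c_{1,α} = 2^α Γ((1+α)/2)/(π^{1/2} |Γ(-α/2)|)`. -/
noncomputable def fracC (α : ℝ) : ℝ :=
  2 ^ α * Real.Gamma ((1 + α) / 2) / (Real.pi ^ ((1 : ℝ) / 2) * |Real.Gamma (-α / 2)|)

/-- The one-dimensional fractional Laplacian `(-Δ)^{α/2} g`, defined so that
`-(-Δ)^{α/2} g (x) = c_{1,α} ∫ (g(x+z) - g(x) - g'(x) z 1_{|z|≤1}) |z|^{-(1+α)} dz`. -/
noncomputable def fracLap1 (α : ℝ) (g : ℝ → ℝ) (x : ℝ) : ℝ :=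
  -(fracC α *
    ∫ z : ℝ, (g (x + z) - g x - deriv g x * z * (if |z| ≤ 1 then 1 else 0)) * |z| ^ (-(1 + α)))

/-- The one-dimensional fractional drift
`b(x) = -e^{V(x)} ∫_{-∞}^x (-Δ)^{α/2} e^{-V(u)} du`. -/
noncomputable def fracDrift1 (α : ℝ) (V : ℝ → ℝ) (x : ℝ) : ℝ :=
  -Real.exp (V x) * ∫ u in Set.Iic x, fracLap1 α (fun y => Real.exp (-(V y))) u

lemma aux_taylor (g : ℝ → ℝ) (hg : ContDiff ℝ 2 g) (M : ℝ)
    (h2 : ∀ y, |deriv (deriv g) y| ≤ M) (x z : ℝ) :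
    |g (x + z) - g x - deriv g x * z| ≤ M * z ^ 2 := by
  have hM : 0 ≤ M := (abs_nonneg _).trans (h2 0)
  have hd : Differentiable ℝ g := hg.differentiable (by norm_num)
  have hd' : Differentiable ℝ (deriv g) := by
    have : ContDiff ℝ 1 (deriv g) := (contDiff_succ_iff_deriv (n := 1).1 (by rw [one_add_one_eq_two]; exact hg)).2.2
    exact this.differentiable (by norm_num)
  have hlip : ∀ a b, |deriv g b - deriv g a| ≤ M * |b - a| := by
    intro a b
    exact Convex.norm_image_sub_le_of_norm_deriv_le (s := Set.univ) (f := deriv g) (C := M)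
      (fun y _ => hd' y) (fun y _ => h2 y) convex_univ (Set.mem_univ a) (Set.mem_univ b)
  have hD : ∀ w, HasDerivAt (fun w => g (x + w) - g x - deriv g x * w)
      (deriv g (x + w) - deriv g x) w := by
    intro w
    have h1 : HasDerivAt (fun w => g (x + w)) (deriv g (x + w)) w :=
      (hd (x + w)).hasDerivAt.comp_const_add x w
    have h3 : HasDerivAt (fun w : ℝ => deriv g x * w) (deriv g x) w := by
      simpa using (hasDerivAt_id w).const_mul (deriv g x)
    exact (h1.sub_const (g x)).sub h3
  have := Convex.norm_image_sub_le_of_norm_hasDerivWithin_le (s := Set.uIcc 0 z) (C := M * |z|)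
    (f := fun w => g (x + w) - g x - deriv g x * w) (x := 0) (y := z)
    (fun w _ => (hD w).hasDerivWithinAt) (fun w hw => by
      have h := hlip x (x + w)
      have hw' : |w| ≤ |z| := by
        have := Set.abs_sub_left_of_mem_uIcc hw
        simpa using this
      rw [Real.norm_eq_abs]
      refine h.trans ?_
      rw [add_sub_cancel_left]
      gcongr) (convex_uIcc 0 z) Set.left_mem_uIcc Set.right_mem_uIcc
  simp only [Real.norm_eq_abs, add_zero, sub_self, mul_zero, sub_zero] at this
  rw [mul_assoc, abs_mul_abs_self] at this
  rw [pow_two]; exact this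

lemma aux_mid (g : ℝ → ℝ) (hg : ContDiff ℝ 2 g) (a e : ℝ)
    (h2 : ∀ y, a ≤ y → -e ≤ deriv (deriv g) y) (x z : ℝ) (h1 : a ≤ x - z) (h3 : a ≤ x + z) :
    -(e * z ^ 2) ≤ g (x + z) + g (x - z) - 2 * g x := by
  have hd : Differentiable ℝ g := hg.differentiable (by norm_num)
  have hd' : Differentiable ℝ (deriv g) := by
    have : ContDiff ℝ 1 (deriv g) := (contDiff_succ_iff_deriv (n := 1).1 (by rw [one_add_one_eq_two]; exact hg)).2.2
    exact this.differentiable (by norm_num)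
  have e1 : ∀ y, HasDerivAt (fun y => g y + e / 2 * y ^ 2) (deriv g y + e * y) y := by
    intro y
    have := (hd y).hasDerivAt.add (((hasDerivAt_id y).pow 2).const_mul (e / 2))
    convert! this using 1
    simp; ring
  have e1' : deriv (fun y => g y + e / 2 * y ^ 2) = fun y => deriv g y + e * y :=
    funext fun y => (e1 y).deriv
  have e2 : ∀ y, HasDerivAt (fun y => deriv g y + e * y) (deriv (deriv g) y + e) y := by
    intro y
    have := (hd' y).hasDerivAt.add ((hasDerivAt_id y).const_mul e)
    convert! this using 1
    simp
  have hc : ConvexOn ℝ (Set.Ici a) (fun y => g y + e / 2 * y ^ 2) := by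
    apply convexOn_of_deriv2_nonneg' (convex_Ici a)
    · exact fun y _ => (e1 y).differentiableAt.differentiableWithinAt
    · rw [e1']
      exact fun y _ => (e2 y).differentiableAt.differentiableWithinAt
    · intro y hy
      simp only [Function.iterate_succ, Function.iterate_zero, Function.comp_apply, id]
      rw [e1', (e2 y).deriv]
      linarith [h2 y hy]
  have := hc.2 (show x - z ∈ Set.Ici a from h1) (show x + z ∈ Set.Ici a from h3)
    (show (0:ℝ) ≤ 1/2 by norm_num) (show (0:ℝ) ≤ 1/2 by norm_num) (by norm_num)
  simp only [smul_eq_mul] at this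
  rw [show 1/2 * (x - z) + 1/2 * (x + z) = x by ring] at this
  nlinarith [this]

lemma aux_int (α : ℝ) (h0 : 0 < α) (h2 : α < 2) (P : ℝ → ℝ) (hP : Measurable P) (M : ℝ)
    (hs : ∀ z, 0 < z → z ≤ 1 → |P z| ≤ M * z ^ 2) (hl : ∀ z, 1 < z → |P z| ≤ M) :
    IntegrableOn (fun z => P z * |z| ^ (-(1 + α))) (Set.Ioi 0) := by
  have hm : Measurable (fun z : ℝ => P z * |z| ^ (-(1 + α))) := by fun_prop
  rw [← Set.Ioc_union_Ioi_eq_Ioi (zero_le_one' ℝ)]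
  refine IntegrableOn.union ?_ ?_
  · have hb : IntegrableOn (fun z : ℝ => M * z ^ (1 - α)) (Set.Ioc 0 1) := by
      have := intervalIntegral.intervalIntegrable_rpow' (a := 0) (b := 1) (r := 1 - α) (by linarith)
      rw [intervalIntegrable_iff_integrableOn_Ioc_of_le zero_le_one] at this
      exact this.const_mul M
    refine Integrable.mono' hb hm.aestronglyMeasurable ?_
    refine (ae_restrict_mem measurableSet_Ioc).mono fun z hz => ?_
    rw [norm_mul, Real.norm_eq_abs, Real.norm_eq_abs, abs_of_pos hz.1,
      abs_of_nonneg (rpow_nonneg hz.1.le _)]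
    have : z ^ (1 - α) = z ^ 2 * z ^ (-(1 + α)) := by
      rw [← rpow_two, ← rpow_add hz.1]; congr 1; ring
    rw [this, ← mul_assoc]
    exact mul_le_mul_of_nonneg_right (hs z hz.1 hz.2) (rpow_nonneg hz.1.le _)
  · have hb : IntegrableOn (fun z : ℝ => M * z ^ (-(1 + α))) (Set.Ioi 1) :=
      (integrableOn_Ioi_rpow_of_lt (by linarith) one_pos).const_mul M
    refine Integrable.mono' hb hm.aestronglyMeasurable ?_
    refine (ae_restrict_mem measurableSet_Ioi).mono fun z hz => ?_
    have hz0 : 0 < z := one_pos.trans hz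
    rw [norm_mul, Real.norm_eq_abs, Real.norm_eq_abs, abs_of_pos hz0,
      abs_of_nonneg (rpow_nonneg hz0.le _)]
    exact mul_le_mul_of_nonneg_right (hl z hz) (rpow_nonneg hz0.le _)

lemma aux_core (α : ℝ) (h0 : 0 < α) (ha2 : α < 2) (g : ℝ → ℝ) (hg : ContDiff ℝ 2 g)
    (hpos : ∀ y, 0 < g y) (M : ℝ) (hM : ∀ y, g y ≤ M)
    (h2 : ∀ y, |deriv (deriv g) y| ≤ M) (x e m : ℝ) (hx : 2 < x)
    (he : ∀ y, x / 2 ≤ y → -e ≤ deriv (deriv g) y) (hm0 : 0 ≤ m)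
    (hm : ∀ y, |y| ≤ 1 → m ≤ g y) :
    -(e * ((x / 2) ^ (2 - α) / (2 - α))) - 2 * g x * ((x / 2) ^ (-α) / α)
        + 2 * (m * (2 * x) ^ (-(1 + α))) ≤
      ∫ z : ℝ, (g (x + z) - g x - deriv g x * z * (if |z| ≤ 1 then 1 else 0))
        * |z| ^ (-(1 + α)) := by
  have hgm : Measurable g := hg.continuous.measurable
  set P : ℝ → ℝ := fun z => g (x + z) - g x - deriv g x * z * (if |z| ≤ 1 then 1 else 0) with hPdef
  have hPm : Measurable P := by
    have : Measurable (fun z : ℝ => if |z| ≤ 1 then (1:ℝ) else 0) :=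
      Measurable.ite (measurableSet_le (by fun_prop) (by fun_prop)) (by fun_prop) (by fun_prop)
    fun_prop
  have hPs : ∀ z, |z| ≤ 1 → |P z| ≤ M * z ^ 2 := by
    intro z hz
    simp only [hPdef, hz, if_true, mul_one]
    exact aux_taylor g hg M h2 x z
  have hPl : ∀ z, 1 < |z| → |P z| ≤ M := by
    intro z hz
    simp only [hPdef, not_le.2 hz, if_false, mul_zero, sub_zero]
    rw [abs_le]
    constructor <;> linarith [hpos x, hM x, hpos (x+z), hM (x+z)]
  have i1 : IntegrableOn (fun z => P z * |z| ^ (-(1 + α))) (Set.Ioi 0) :=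
    aux_int α h0 ha2 P hPm M (fun z hz hz1 => hPs z (by rwa [abs_of_pos hz]))
      (fun z hz => hPl z (by rwa [abs_of_pos (one_pos.trans hz)]))
  have i2 : IntegrableOn (fun z => P (-z) * |z| ^ (-(1 + α))) (Set.Ioi 0) :=
    aux_int α h0 ha2 (fun z => P (-z)) (by fun_prop) M
      (fun z hz hz1 => by
        have := hPs (-z) (by rwa [abs_neg, abs_of_pos hz])
        rwa [neg_sq] at this)
      (fun z hz => hPl (-z) (by rwa [abs_neg, abs_of_pos (one_pos.trans hz)]))
  have i3 : IntegrableOn (fun z => P z * |z| ^ (-(1 + α))) (Set.Iic 0) := by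
    rw [integrableOn_Iic_iff_integrableOn_Iio]
    have := (Measure.measurePreserving_neg (volume : Measure ℝ)).integrableOn_comp_preimage
      (MeasurableEquiv.neg ℝ).measurableEmbedding
      (f := fun z => P z * |z| ^ (-(1 + α))) (s := Set.Iio 0)
    rw [← this]
    simpa [Function.comp_def] using i2
  have hint : Integrable (fun z => P z * |z| ^ (-(1 + α))) := by
    rw [← integrableOn_univ, ← Set.Iic_union_Ioi (a := (0:ℝ))]
    exact i3.union i1
  have hsplit : ∫ z : ℝ, P z * |z| ^ (-(1 + α)) =
      ∫ z in Set.Ioi 0, (P z * |z| ^ (-(1 + α)) + P (-z) * |z| ^ (-(1 + α))) := by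
    rw [integral_add i1 i2, ← integral_add_compl measurableSet_Ioi hint, Set.compl_Ioi]
    congr 1
    have := integral_comp_neg_Ioi (0:ℝ) (fun z => P z * |z| ^ (-(1 + α)))
    simp only [abs_neg, neg_zero] at this
    exact this.symm
  rw [hsplit]
  have hG : IntegrableOn (fun z => P z * |z| ^ (-(1 + α)) + P (-z) * |z| ^ (-(1 + α)))
      (Set.Ioi 0) := i1.add i2
  have hGe : ∀ z, 0 < z → (P z * |z| ^ (-(1 + α)) + P (-z) * |z| ^ (-(1 + α))) =
      (g (x + z) + g (x - z) - 2 * g x) * z ^ (-(1 + α)) := by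
    intro z hz
    simp only [hPdef, abs_neg, ← sub_eq_add_neg, abs_of_pos hz]
    ring
  have hx2 : 0 < x / 2 := by linarith
  rw [← Set.Ioc_union_Ioi_eq_Ioi hx2.le, setIntegral_union
    (t := Set.Ioi (x / 2)) (Set.disjoint_left.2 fun z hz hz' => not_lt.2 hz.2 hz') measurableSet_Ioi
    (hG.mono_set Set.Ioc_subset_Ioi_self) (hG.mono_set (Set.Ioi_subset_Ioi hx2.le))]
  have p1 : -(e * ((x / 2) ^ (2 - α) / (2 - α))) ≤
      ∫ z in Set.Ioc 0 (x/2), (P z * |z| ^ (-(1 + α)) + P (-z) * |z| ^ (-(1 + α))) := by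
    have hI := intervalIntegral.intervalIntegrable_rpow' (a := 0) (b := x/2) (r := 1 - α)
      (by linarith)
    rw [intervalIntegrable_iff_integrableOn_Ioc_of_le hx2.le] at hI
    have hv : ∫ z in Set.Ioc 0 (x/2), (-e) * z ^ (1 - α) =
        -(e * ((x / 2) ^ (2 - α) / (2 - α))) := by
      rw [integral_const_mul, ← intervalIntegral.integral_of_le hx2.le,
        integral_rpow (Or.inl (by linarith)), show 1 - α + 1 = 2 - α by ring,
        zero_rpow (by linarith)]
      ring
    rw [← hv]
    refine setIntegral_mono_on (hI.const_mul (-e)) (hG.mono_set Set.Ioc_subset_Ioi_self)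
      measurableSet_Ioc fun z hz => ?_
    rw [hGe z hz.1]
    have : z ^ (1 - α) = z ^ 2 * z ^ (-(1 + α)) := by
      rw [← rpow_two, ← rpow_add hz.1]; congr 1; ring
    rw [this, ← mul_assoc]
    refine mul_le_mul_of_nonneg_right ?_ (rpow_nonneg hz.1.le _)
    have := aux_mid g hg (x/2) e he x z (by linarith [hz.2]) (by linarith [hz.1])
    linarith
  have p2 : - 2 * g x * ((x / 2) ^ (-α) / α) + 2 * (m * (2 * x) ^ (-(1 + α))) ≤
      ∫ z in Set.Ioi (x/2), (P z * |z| ^ (-(1 + α)) + P (-z) * |z| ^ (-(1 + α))) := by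
    have hI := (integrableOn_Ioi_rpow_of_lt (a := -(1 + α)) (by linarith) hx2).const_mul (-2 * g x)
    have hJ : Integrable ((Set.Icc (x-1) (x+1)).indicator
        (fun _ : ℝ => m * (2 * x) ^ (-(1 + α)))) (volume.restrict (Set.Ioi (x/2))) := by
      refine Integrable.restrict ?_
      rw [integrable_indicator_iff measurableSet_Icc]
      exact integrableOn_const (by simp)
    have hv : ∫ z in Set.Ioi (x/2), ((-2 * g x) * z ^ (-(1 + α)) +
        (Set.Icc (x-1) (x+1)).indicator (fun _ : ℝ => m * (2 * x) ^ (-(1 + α))) z) =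
        - 2 * g x * ((x / 2) ^ (-α) / α) + 2 * (m * (2 * x) ^ (-(1 + α))) := by
      rw [integral_add hI hJ, integral_const_mul, integral_Ioi_rpow_of_lt (by linarith) hx2,
        setIntegral_indicator measurableSet_Icc, show -(1 + α) + 1 = -α by ring,
        Set.inter_eq_self_of_subset_right, setIntegral_const, neg_div_neg_eq]
      · congr 1
        rw [measureReal_def, Real.volume_Icc, show x + 1 - (x - 1) = 2 by ring]
        simp
      · intro z hz
        simp only [Set.mem_Ioi]
        linarith [hz.1]
    rw [← hv]
    refine setIntegral_mono_on (hI.add hJ) (hG.mono_set (Set.Ioi_subset_Ioi hx2.le))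
      measurableSet_Ioi fun z hz => ?_
    have hz0 : 0 < z := hx2.trans hz
    rw [hGe z hz0]
    have hr := rpow_nonneg hz0.le (-(1 + α))
    have q1 := mul_nonneg (hpos (x + z)).le hr
    by_cases hzz : z ∈ Set.Icc (x-1) (x+1)
    · rw [Set.indicator_of_mem hzz]
      have q2 : m * (2 * x) ^ (-(1 + α)) ≤ g (x - z) * z ^ (-(1 + α)) := by
        refine mul_le_mul (hm _ ?_) ?_ (rpow_nonneg (by linarith) _) (hpos _).le
        · rw [abs_le]; constructor <;> linarith [hzz.1, hzz.2]
        · exact rpow_le_rpow_of_nonpos hz0 (by linarith [hzz.2]) (by linarith)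
      linarith
    · rw [Set.indicator_of_notMem hzz]
      have q1 := mul_nonneg (hpos (x - z)).le hr
      linarith
  linarith

theorem stmt_13 (α : ℝ) (hα : α ∈ Set.Ioc (0 : ℝ) 1)
    (V : ℝ → ℝ) (hV : ContDiff ℝ 2 V)
    (hsym : ∀ x : ℝ, V x = V (-x))
    (hL1 : Integrable (fun x => Real.exp (-(V x))))
    (hCb2 : ∃ M : ℝ, ∀ x : ℝ, Real.exp (-(V x)) ≤ M ∧
      |deriv (fun y => Real.exp (-(V y))) x| ≤ M ∧
      |deriv (deriv (fun y => Real.exp (-(V y)))) x| ≤ M)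
    (hlim : ∃ M R : ℝ, ∀ x : ℝ, R ≤ |x| →
      |x| ^ 3 * Real.exp (-(V x)) * |(deriv V x) ^ 2 - deriv (deriv V) x| ≤ M)
    (hxe : Tendsto (fun x => x * Real.exp (-(V x))) atTop (nhds 0))
    (hliminf : ∀ ε : ℝ, 0 < ε → ∀ᶠ x in atTop,
      -ε ≤ x ^ 3 * Real.exp (-(V x)) * ((deriv V x) ^ 2 - deriv (deriv V) x)) :
    ∃ c R : ℝ, 0 < c ∧ 0 < R ∧ ∀ x : ℝ, R ≤ x →
      c * x ^ (-(1 + α)) ≤ -fracLap1 α (fun y => Real.exp (-(V y))) x := by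
  obtain ⟨h0, h1⟩ := hα
  obtain ⟨M, hM⟩ := hCb2
  set g : ℝ → ℝ := fun y => Real.exp (-(V y)) with hgdef
  have hg : ContDiff ℝ 2 g := hV.neg.exp
  have hpos : ∀ y, 0 < g y := fun y => Real.exp_pos _
  have hVd : Differentiable ℝ V := hV.differentiable (by norm_num)
  have hVd' : Differentiable ℝ (deriv V) := by
    have : ContDiff ℝ 1 (deriv V) := (contDiff_succ_iff_deriv (n := 1).1 (by rw [one_add_one_eq_two]; exact hV)).2.2
    exact this.differentiable (by norm_num)
  have d1 : ∀ y, HasDerivAt g (g y * (-deriv V y)) y := fun y => (hVd y).hasDerivAt.neg.exp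
  have d1' : deriv g = fun y => g y * (-deriv V y) := funext fun y => (d1 y).deriv
  have d2 : ∀ y, deriv (deriv g) y = g y * ((deriv V y) ^ 2 - deriv (deriv V) y) := by
    intro y
    have h := (d1 y).mul (hVd' y).hasDerivAt.neg
    have h' : HasDerivAt (fun y => g y * (-deriv V y)) _ y := h
    rw [d1', h'.deriv]
    simp only [Pi.neg_apply]
    ring
  obtain ⟨y0, -, hy0⟩ := (isCompact_Icc (a := (-1:ℝ)) (b := 1)).exists_isMinOn
    ⟨0, by norm_num⟩ hg.continuous.continuousOn
  set m := g y0 with hmdef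
  have hm : 0 < m := hpos y0
  have hmin : ∀ y, |y| ≤ 1 → m ≤ g y := fun y hy => hy0 (abs_le.1 hy)
  have hC : 0 < fracC α := by
    unfold fracC
    have : Real.Gamma (-α / 2) ≠ 0 := by
      apply Real.Gamma_ne_zero
      intro n hn
      rcases n with _ | n
      · simp at hn; linarith
      · push_cast at hn
        have : (0:ℝ) ≤ n := n.cast_nonneg
        linarith
    have h3 : 0 < Real.Gamma ((1 + α) / 2) := Real.Gamma_pos_of_pos (by linarith)
    have := abs_pos.2 this
    positivity
  obtain ⟨R1, hR1⟩ := eventually_atTop.1 (hliminf (m / 64) (by positivity))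
  obtain ⟨R2, hR2⟩ := eventually_atTop.1
    (hxe.eventually (gt_mem_nhds (show (0:ℝ) < m * α / 32 by positivity)))
  refine ⟨fracC α * (m / 4), max 3 (max (2 * R1) R2), by positivity, by positivity, fun x hx => ?_⟩
  have hx3 : 3 ≤ x := (le_max_left _ _).trans hx
  have hxR1 : 2 * R1 ≤ x := (le_max_left _ _).trans ((le_max_right _ _).trans hx)
  have hxR2 : R2 ≤ x := (le_max_right _ _).trans ((le_max_right _ _).trans hx)
  have hx0 : 0 < x := by linarith
  unfold fracLap1
  rw [neg_neg, mul_assoc]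
  refine mul_le_mul_of_nonneg_left ?_ hC.le
  refine le_trans ?_ (aux_core α h0 (by linarith) g hg hpos M (fun y => (hM y).1)
    (fun y => (hM y).2.2) x (m / 64 * 8 / x ^ 3) m (by linarith) ?_ hm.le hmin)
  · set X := x ^ (-(1 + α)) with hX
    have hXpos : 0 < X := rpow_pos_of_pos hx0 _
    have a1 : m / 64 * 8 / x ^ 3 * ((x / 2) ^ (2 - α) / (2 - α)) ≤ m / 8 * X := by
      have t1 : (x / 2) ^ (2 - α) ≤ x ^ (2 - α) :=
        rpow_le_rpow (by positivity) (by linarith) (by linarith)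
      have t2 : (x / 2) ^ (2 - α) / (2 - α) ≤ x ^ (2 - α) := by
        rw [div_le_iff₀ (by linarith)]
        have := rpow_nonneg hx0.le (2 - α)
        nlinarith
      have t3 : x ^ (2 - α) = x ^ 3 * X := by
        rw [hX, ← rpow_natCast x 3, ← rpow_add hx0]; congr 1; push_cast; ring
      rw [t3] at t2
      calc _ ≤ m / 64 * 8 / x ^ 3 * (x ^ 3 * X) := by gcongr
        _ = m / 8 * X := by field_simp; norm_num
    have a2 : 2 * g x * ((x / 2) ^ (-α) / α) ≤ m / 8 * X := by
      have t1 : (x / 2) ^ (-α) ≤ 2 * (x * X) := by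
        rw [div_rpow hx0.le (by norm_num), hX]
        have : x * x ^ (-(1 + α)) = x ^ (-α) := by
          nth_rw 1 [← rpow_one x]
          rw [← rpow_add hx0]; congr 1; ring
        rw [this, rpow_neg (by norm_num : (0:ℝ) ≤ 2), div_inv_eq_mul, mul_comm]
        have h2 : (2:ℝ) ^ α ≤ 2 := by
          simpa using rpow_le_rpow_of_exponent_le (by norm_num : (1:ℝ) ≤ 2) h1
        exact mul_le_mul_of_nonneg_right h2 (rpow_nonneg hx0.le _)
      have t2 : x * g x < m * α / 32 := hR2 x hxR2
      calc 2 * g x * ((x / 2) ^ (-α) / α) ≤ 2 * g x * ((2 * (x * X)) / α) := by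
            have := (hpos x).le
            gcongr
        _ = 4 * (x * g x) * X / α := by ring
        _ ≤ 4 * (m * α / 32) * X / α := by gcongr
        _ = m / 8 * X := by field_simp; norm_num
    have a3 : m / 2 * X ≤ 2 * (m * (2 * x) ^ (-(1 + α))) := by
      rw [mul_rpow (by norm_num) hx0.le, ← hX]
      have h2 : (1/4:ℝ) ≤ 2 ^ (-(1 + α)) := by
        have := rpow_le_rpow_of_exponent_le (by norm_num : (1:ℝ) ≤ 2)
          (show (-2:ℝ) ≤ -(1 + α) by linarith)
        rw [rpow_neg (by norm_num : (0:ℝ) ≤ 2), rpow_two] at this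
        norm_num at this ⊢
        linarith
      have := mul_le_mul_of_nonneg_left h2 (mul_pos hm hXpos).le
      linarith
    linarith
  · intro y hy
    have hy0 : 0 < y := by linarith
    have := hR1 y (by linarith)
    rw [mul_assoc] at this
    have hd := d2 y
    rw [hd]
    have h8 : x ^ 3 ≤ 8 * y ^ 3 := by
      have : x ^ 3 ≤ (2 * y) ^ 3 := pow_le_pow_left₀ hx0.le (by linarith) 3
      linarith [this, mul_pow 2 y 3]
    set D := g y * ((deriv V y) ^ 2 - deriv (deriv V) y) with hD
    have hthis : -(m / 64) ≤ y ^ 3 * D := this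
    have hy3 : 0 < y ^ 3 := by positivity
    have e1 : -(m / 64) / y ^ 3 ≤ D := by
      rw [div_le_iff₀ hy3]; linarith
    refine le_trans ?_ e1
    rw [neg_div, neg_le_neg_iff, div_le_div_iff₀ hy3 (by positivity)]
    nlinarith
end

section
/- Let α ∈ (0,1] and let V ∈ C²(ℝ) be a symmetric function (V(x) = V(−x) for all x ∈ ℝ) such that e^{−V} ∈ L¹(ℝ; dx) ∩ C_b²(ℝ). Suppose that limsup_{|x|→∞} |x|³ e^{−V(x)} |V'(x)² − V''(x)| < ∞, that lim_{x→∞} x e^{−V(x)} = 0, and that liminf_{x→∞} x³ e^{−V(x)} (V'(x)² − V''(x)) ≥ 0. Then there exist constants c₁, c₂ > 0 and r₁ > 1 such that for all x ∈ ℝ: x·b(x) ≤ c₁ if |x| ≤ r₁, and x·b(x) ≤ −c₂ e^{V(x)} |x|^{−(1+α)} |x|² if |x| > r₁. -/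
open MeasureTheory Real Filter

lemma taylor_aux (g g' g'' : ℝ → ℝ) (hg : ∀ x, HasDerivAt g (g' x) x)
    (hg' : ∀ x, HasDerivAt g' (g'' x) x) (u z k : ℝ)
    (hk : ∀ v, |v - u| ≤ |z| → |g'' v| ≤ k) :
    |g (u + z) - g u - g' u * z| ≤ k * z ^ 2 := by
  have hconv : Convex ℝ (Metric.closedBall u |z|) := convex_closedBall u |z|
  have hu : u ∈ Metric.closedBall u |z| := by simp
  have hk0 : 0 ≤ k := (abs_nonneg _).trans (hk u (by simp))
  have h1 : ∀ v ∈ Metric.closedBall u |z|, |g' v - g' u| ≤ k * |z| := by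
    intro v hv
    have := hconv.norm_image_sub_le_of_norm_hasDerivWithin_le (f := g') (f' := g'') (C := k)
      (fun x _ => (hg' x).hasDerivWithinAt)
      (fun x hx => hk x (by simpa [Real.dist_eq] using hx)) hu hv
    simp only [Real.norm_eq_abs] at this
    refine this.trans ?_
    have : |v - u| ≤ |z| := by simpa [Real.dist_eq] using hv
    gcongr
  have hz : u + z ∈ Metric.closedBall u |z| := by simp
  have h2 := hconv.norm_image_sub_le_of_norm_hasDerivWithin_le
      (f := fun v => g v - g' u * v) (f' := fun v => g' v - g' u) (C := k * |z|)
      (fun x _ => by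
        have := (hg x).sub ((hasDerivAt_id x).const_mul (g' u))
        refine HasDerivAt.hasDerivWithinAt ?_
        refine HasDerivAt.congr_deriv (f' := g' x - g' u * 1) this (by ring))
      h1 hu hz
  simp only [Real.norm_eq_abs] at h2
  have e : g (u + z) - g' u * (u + z) - (g u - g' u * u) = g (u + z) - g u - g' u * z := by ring
  rw [e] at h2
  refine h2.trans (le_of_eq ?_)
  rw [add_sub_cancel_left, mul_assoc, abs_mul_abs_self, sq]

lemma second_diff_aux (g g' g'' : ℝ → ℝ) (hg : ∀ x, HasDerivAt g (g' x) x)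
    (hg' : ∀ x, HasDerivAt g' (g'' x) x) (u z k : ℝ) (hz : 0 ≤ z)
    (hk : ∀ v, |v - u| ≤ z → -k ≤ g'' v) :
    -k * z ^ 2 ≤ g (u + z) + g (u - z) - 2 * g u := by
  have hc : ConvexOn ℝ (Set.Icc (u - z) (u + z)) (fun v => g v + k / 2 * v ^ 2) := by
    refine convexOn_of_hasDerivWithinAt2_nonneg (f' := fun v => g' v + k * v)
      (f'' := fun v => g'' v + k) (convex_Icc _ _) ?_ ?_ ?_ ?_
    · have : Continuous g := continuous_iff_continuousAt.2 fun x => (hg x).continuousAt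
      fun_prop
    · intro x _
      have := (hg x).add (((hasDerivAt_id x).pow 2).const_mul (k / 2))
      refine HasDerivAt.hasDerivWithinAt ?_
      exact HasDerivAt.congr_deriv this (by simp; ring)
    · intro x _
      have := (hg' x).add ((hasDerivAt_id x).const_mul k)
      refine HasDerivAt.hasDerivWithinAt ?_
      exact HasDerivAt.congr_deriv this (by simp)
    · intro x hx
      have hx := interior_subset hx
      have := hk x (abs_le.2 ⟨by linarith [hx.1], by linarith [hx.2]⟩)
      linarith
  have hl : u - z ∈ Set.Icc (u - z) (u + z) := ⟨le_rfl, by linarith⟩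
  have hr : u + z ∈ Set.Icc (u - z) (u + z) := ⟨by linarith, le_rfl⟩
  have := hc.right hl hr (show (0 : ℝ) ≤ 1 / 2 by norm_num) (show (0 : ℝ) ≤ 1 / 2 by norm_num)
    (by norm_num)
  have e : (1/2 : ℝ) • (u - z) + (1/2 : ℝ) • (u + z) = u := by simp; ring
  rw [e] at this
  simp only [smul_eq_mul] at this
  nlinarith

/-- weights -/
noncomputable def wIn (α z : ℝ) : ℝ := if |z| ≤ 1 then |z| ^ (1 - α) else 0
noncomputable def wOut (α z : ℝ) : ℝ := if |z| ≤ 1 then 0 else |z| ^ (-(1 + α))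

lemma wIn_nonneg (α z : ℝ) : 0 ≤ wIn α z := by unfold wIn; split_ifs <;> positivity
lemma wOut_nonneg (α z : ℝ) : 0 ≤ wOut α z := by unfold wOut; split_ifs <;> positivity

lemma wIn_meas (α : ℝ) : Measurable (wIn α) :=
  Measurable.ite (measurableSet_le (by fun_prop) (by fun_prop)) (by fun_prop) (by fun_prop)
lemma wOut_meas (α : ℝ) : Measurable (wOut α) :=
  Measurable.ite (measurableSet_le (by fun_prop) (by fun_prop)) (by fun_prop) (by fun_prop)

lemma wIn_int (α : ℝ) (hα : α ∈ Set.Ioc (0 : ℝ) 1) : Integrable (wIn α) := by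
  have : Integrable (Set.indicator (Set.Icc (-1 : ℝ) 1) (fun _ => (1 : ℝ))) := by
    rw [integrable_indicator_iff measurableSet_Icc]
    exact integrableOn_const (by simp)
  refine this.mono' (wIn_meas α).aestronglyMeasurable (Eventually.of_forall fun z => ?_)
  rw [Real.norm_of_nonneg (wIn_nonneg _ _)]
  unfold wIn
  by_cases h : |z| ≤ 1
  · rw [if_pos h, Set.indicator_of_mem (by exact abs_le.1 h)]
    exact Real.rpow_le_one (abs_nonneg _) h (by linarith [hα.2])
  · rw [if_neg h]
    exact Set.indicator_nonneg (fun _ _ => zero_le_one) _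

lemma wOut_int (α : ℝ) (hα : α ∈ Set.Ioc (0 : ℝ) 1) : Integrable (wOut α) := by
  have : Integrable (fun z : ℝ => 2 ^ (1 + α) * (1 + ‖z‖) ^ (-(1 + α))) :=
    (integrable_one_add_norm (by simpa using hα.1)).const_mul _
  refine this.mono' (wOut_meas α).aestronglyMeasurable (Eventually.of_forall fun z => ?_)
  rw [Real.norm_of_nonneg (wOut_nonneg _ _)]
  unfold wOut
  split_ifs with h
  · positivity
  · push Not at h
    have e : (2 : ℝ) ^ (1 + α) = (1 / 2) ^ (-(1 + α)) := by
      rw [Real.rpow_neg (by norm_num), one_div, Real.inv_rpow (by norm_num), inv_inv]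
    rw [e, ← Real.mul_rpow (by norm_num) (by positivity), Real.norm_eq_abs]
    exact Real.rpow_le_rpow_of_nonpos (by positivity) (by linarith) (by linarith [hα.1])

/-- the joint integrand -/
noncomputable def jI (α : ℝ) (g g' : ℝ → ℝ) (u z : ℝ) : ℝ :=
  (g (u + z) - g u - g' u * z * (if |z| ≤ 1 then 1 else 0)) * |z| ^ (-(1 + α))

lemma jI_bound (α : ℝ) (g g' g'' : ℝ → ℝ) (hg : ∀ x, HasDerivAt g (g' x) x)
    (hg' : ∀ x, HasDerivAt g' (g'' x) x) (hpos : ∀ x, 0 < g x)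
    (K : ℝ) (hK : ∀ x, |g'' x| ≤ K * (1 + x ^ 2)⁻¹) (u z : ℝ) :
    |jI α g g' u z| ≤ 3 * K * (1 + u ^ 2)⁻¹ * wIn α z + (g (u + z) + g u) * wOut α z := by
  have hK0 : 0 ≤ K := by
    have := (abs_nonneg _).trans (hK 0); simpa using this
  unfold jI wIn wOut
  rw [abs_mul, abs_of_nonneg (a := |z| ^ (-(1 + α))) (by positivity)]
  split_ifs with h
  · rw [mul_one, mul_zero, add_zero]
    have h1 := taylor_aux g g' g'' hg hg' u z (3 * K * (1 + u ^ 2)⁻¹) (by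
      intro v hv
      refine (hK v).trans ?_
      have : |v - u| ≤ 1 := hv.trans h
      have : (v - u) ^ 2 ≤ 1 := by rw [← sq_abs]; nlinarith [abs_nonneg (v - u)]
      have h3 : 1 + u ^ 2 ≤ 3 * (1 + v ^ 2) := by nlinarith [sq_nonneg (2 * v - u)]
      have h4 : (1 + v ^ 2)⁻¹ ≤ 3 * (1 + u ^ 2)⁻¹ := by
        rw [inv_eq_one_div, inv_eq_one_div, ← mul_div_assoc, mul_one, div_le_div_iff₀ (by positivity) (by positivity)]
        linarith
      nlinarith)
    refine (mul_le_mul_of_nonneg_right h1 (by positivity)).trans ?_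
    rw [mul_assoc]
    refine mul_le_mul_of_nonneg_left ?_ (by positivity)
    rcases eq_or_ne z 0 with rfl | hz
    · simp only [ne_eq, OfNat.ofNat_ne_zero, not_false_eq_true, zero_pow, zero_mul]
      positivity
    · refine le_of_eq ?_
      rw [← sq_abs, ← Real.rpow_natCast, ← Real.rpow_add (by positivity)]
      congr 1; push_cast; ring
  · rw [mul_zero, sub_zero, mul_zero, zero_add]
    gcongr
    rw [abs_le]
    constructor <;> linarith [hpos u, hpos (u + z)]

lemma jI_int (α : ℝ) (hα : α ∈ Set.Ioc (0 : ℝ) 1) (g g' g'' : ℝ → ℝ) (hg : ∀ x, HasDerivAt g (g' x) x)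
    (hg' : ∀ x, HasDerivAt g' (g'' x) x) (hpos : ∀ x, 0 < g x) (hint : Integrable g)
    (K : ℝ) (hK : ∀ x, |g'' x| ≤ K * (1 + x ^ 2)⁻¹) :
    Integrable (Function.uncurry (jI α g g')) (volume.prod volume) := by
  have hgc : Measurable g := (continuous_iff_continuousAt.2 fun x => (hg x).continuousAt).measurable
  have hgc' : Measurable g' := (continuous_iff_continuousAt.2 fun x => (hg' x).continuousAt).measurable
  have hm : Measurable (Function.uncurry (jI α g g')) := by
    unfold jI Function.uncurry
    have : Measurable (fun a : ℝ × ℝ => if |a.2| ≤ 1 then (1 : ℝ) else 0) :=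
      Measurable.ite (measurableSet_le (by fun_prop) (by fun_prop)) (by fun_prop) (by fun_prop)
    fun_prop
  have i1 : Integrable (fun p : ℝ × ℝ => 3 * K * (1 + p.1 ^ 2)⁻¹ * wIn α p.2) (volume.prod volume) :=
    (integrable_inv_one_add_sq.const_mul (3 * K)).mul_prod (wIn_int α hα)
  have i2 : Integrable (fun p : ℝ × ℝ => g p.1 * wOut α p.2) (volume.prod volume) :=
    hint.mul_prod (wOut_int α hα)
  have i3 : Integrable (fun p : ℝ × ℝ => g (p.1 + p.2) * wOut α p.2) (volume.prod volume) := by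
    have := ((wOut_int α hα).mul_prod hint)
    have := ((measurePreserving_prod_add (volume : Measure ℝ) (volume : Measure ℝ)).integrable_comp this.aestronglyMeasurable).2 this
    have := this.swap
    refine this.congr (Eventually.of_forall fun p => ?_)
    simp [Function.comp, mul_comm, add_comm]
  refine (i1.add (i3.add i2)).mono' hm.aestronglyMeasurable (Eventually.of_forall fun p => ?_)
  have := jI_bound α g g' g'' hg hg' hpos K hK p.1 p.2
  simp only [Pi.add_apply, Function.uncurry, Real.norm_eq_abs]
  linarith

lemma jI_total (α : ℝ) (hα : α ∈ Set.Ioc (0 : ℝ) 1) (g g' g'' : ℝ → ℝ) (hg : ∀ x, HasDerivAt g (g' x) x)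
    (hg' : ∀ x, HasDerivAt g' (g'' x) x) (hpos : ∀ x, 0 < g x) (hint : Integrable g)
    (K : ℝ) (hK : ∀ x, |g'' x| ≤ K * (1 + x ^ 2)⁻¹) :
    ∫ u, ∫ z, jI α g g' u z = 0 := by
  rw [integral_integral_swap (jI_int α hα g g' g'' hg hg' hpos hint K hK)]
  have hgc' : Measurable g' := (continuous_iff_continuousAt.2 fun x => (hg' x).continuousAt).measurable
  have hg'i : Integrable g' := by
    refine (((integrable_inv_one_add_sq.const_mul (3 * K)).add (hint.comp_add_right 1)).add hint).mono'
      hgc'.aestronglyMeasurable (Eventually.of_forall fun u => ?_)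
    have h1 := taylor_aux g g' g'' hg hg' u 1 (3 * K * (1 + u ^ 2)⁻¹) (by
      intro v hv
      refine (hK v).trans ?_
      have hK0 : 0 ≤ K := by
        have := (abs_nonneg _).trans (hK 0); simpa using this
      have : |v - u| ≤ 1 := by simpa using hv
      have : (v - u) ^ 2 ≤ 1 := by rw [← sq_abs]; nlinarith [abs_nonneg (v - u)]
      have h3 : 1 + u ^ 2 ≤ 3 * (1 + v ^ 2) := by nlinarith [sq_nonneg (2 * v - u)]
      have h4 : (1 + v ^ 2)⁻¹ ≤ 3 * (1 + u ^ 2)⁻¹ := by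
        rw [inv_eq_one_div, inv_eq_one_div, ← mul_div_assoc, mul_one, div_le_div_iff₀ (by positivity) (by positivity)]
        linarith
      nlinarith)
    simp only [Pi.add_apply, Real.norm_eq_abs]
    rw [abs_le] at h1 ⊢
    constructor <;> linarith [hpos u, hpos (u + 1)]
  have h0 : ∫ u, g' u = 0 := integral_eq_zero_of_hasDerivAt_of_integrable hg hg'i hint
  rw [← integral_zero ℝ ℝ]
  congr 1
  ext z
  unfold jI
  rw [integral_mul_const, integral_sub, integral_sub, integral_add_right_eq_self, integral_mul_const,
    integral_mul_const, h0]
  · simp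
  · exact hint.comp_add_right z
  · exact hint
  · exact (hint.comp_add_right z).sub hint
  · exact (hg'i.mul_const _).mul_const _

lemma jI_half (α : ℝ) (g g' : ℝ → ℝ) (u : ℝ) (hi : Integrable (jI α g g' u)) :
    IntegrableOn (fun z => (g (u + z) + g (u - z) - 2 * g u) * z ^ (-(1 + α))) (Set.Ioi 0) ∧
    ∫ z, jI α g g' u z =
      ∫ z in Set.Ioi 0, (g (u + z) + g (u - z) - 2 * g u) * z ^ (-(1 + α)) := by
  have key : ∀ z, jI α g g' u z + jI α g g' u (-z) =
      (g (u + |z|) + g (u - |z|) - 2 * g u) * |z| ^ (-(1 + α)) := by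
    intro z
    unfold jI
    rw [abs_neg]
    rcases abs_choice z with h | h <;> rw [h] <;> ring_nf
  have hs : Integrable (fun z => jI α g g' u z + jI α g g' u (-z)) := hi.add hi.comp_neg
  constructor
  · refine (hs.integrableOn (s := Set.Ioi 0)).congr_fun ?_ measurableSet_Ioi
    intro z hz
    have hz : (0 : ℝ) < z := hz
    simp only [key, abs_of_pos hz]
  · have h1 : ∫ z, (jI α g g' u z + jI α g g' u (-z)) = 2 * ∫ z, jI α g g' u z := by
      rw [integral_add hi hi.comp_neg, integral_neg_eq_self]; ring
    have h2 : ∫ z, (jI α g g' u z + jI α g g' u (-z)) =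
        2 * ∫ z in Set.Ioi 0, (g (u + z) + g (u - z) - 2 * g u) * z ^ (-(1 + α)) := by
      rw [← integral_comp_abs (f := fun z => (g (u + z) + g (u - z) - 2 * g u) * z ^ (-(1 + α)))]
      exact integral_congr_ae (Eventually.of_forall key)
    linarith

lemma jI_lower (α : ℝ) (hα : α ∈ Set.Ioc (0 : ℝ) 1) (g g' g'' : ℝ → ℝ) (hg : ∀ x, HasDerivAt g (g' x) x)
    (hg' : ∀ x, HasDerivAt g' (g'' x) x) (hpos : ∀ x, 0 < g x)
    (hxe : Tendsto (fun x => x * g x) atTop (nhds 0))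
    (hl : ∀ ε : ℝ, 0 < ε → ∀ᶠ x in atTop, -ε ≤ x ^ 3 * g'' x) :
    ∃ c N : ℝ, 0 < c ∧ 1 < N ∧ ∀ u, N < u → Integrable (jI α g g' u) →
      c * u ^ (-(1 + α)) ≤ ∫ z, jI α g g' u z := by
  obtain ⟨hα0, hα1⟩ := hα
  have hgc : Continuous g := continuous_iff_continuousAt.2 fun x => (hg x).continuousAt
  obtain ⟨c0, hc0⟩ : ∃ c0, c0 = ∫ x in (-1 : ℝ)..1, g x := ⟨_, rfl⟩
  have hc0p : 0 < c0 := by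
    rw [hc0]
    exact intervalIntegral.intervalIntegral_pos_of_pos (hgc.intervalIntegrable _ _) hpos (by norm_num)
  obtain ⟨ε, hε⟩ : ∃ ε, ε = c0 / 8 / (8 + 4 / α) := ⟨_, rfl⟩
  have hεp : 0 < ε := by rw [hε]; positivity
  have hε2 : ε * (8 + 4 / α) = c0 / 8 := by rw [hε]; field_simp
  have e1 : ∀ᶠ x in atTop, x * g x < ε := hxe.eventually (gt_mem_nhds hεp)
  obtain ⟨N1, hN1⟩ := eventually_atTop.1 e1
  obtain ⟨N2, hN2⟩ := eventually_atTop.1 (hl ε hεp)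
  refine ⟨c0 / 8, max 2 (max N1 (2 * N2)), by positivity, lt_of_lt_of_le (by norm_num) (le_max_left _ _), ?_⟩
  intro u hu hi
  have hu2 : 2 < u := lt_of_le_of_lt (le_max_left _ _) hu
  have huN1 : N1 ≤ u := ((le_max_left _ _).trans (le_max_right _ _)).trans hu.le
  have huN2 : 2 * N2 ≤ u := ((le_max_right _ _).trans (le_max_right _ _)).trans hu.le
  have hu0 : 0 < u := by linarith
  obtain ⟨hfi, heq⟩ := jI_half α g g' u hi
  rw [heq]
  set f : ℝ → ℝ := fun z => (g (u + z) + g (u - z) - 2 * g u) * z ^ (-(1 + α)) with hf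
  have hun : Set.Ioc 0 (u / 2) ∪ Set.Ioi (u / 2) = Set.Ioi (0 : ℝ) := Set.Ioc_union_Ioi_eq_Ioi (by positivity)
  have hfA : IntegrableOn f (Set.Ioc 0 (u / 2)) := hfi.mono_set Set.Ioc_subset_Ioi_self
  have hfB : IntegrableOn f (Set.Ioi (u / 2)) := hfi.mono_set (Set.Ioi_subset_Ioi (by positivity))
  have hsplit : ∫ z in Set.Ioi 0, f z = (∫ z in Set.Ioc 0 (u / 2), f z) + ∫ z in Set.Ioi (u / 2), f z := by
    rw [← hun]
    exact setIntegral_union (Set.Ioc_disjoint_Ioi le_rfl) measurableSet_Ioi hfA hfB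
  -- part A
  have hA : -(8 * ε) * u ^ (-(1 + α)) ≤ ∫ z in Set.Ioc 0 (u / 2), f z := by
    have hii : IntervalIntegrable (fun z : ℝ => z ^ (1 - α)) volume 0 (u / 2) :=
      intervalIntegral.intervalIntegrable_rpow' (by linarith)
    have hi1 : IntegrableOn (fun z : ℝ => -(8 * ε / u ^ 3) * z ^ (1 - α)) (Set.Ioc 0 (u / 2)) :=
      ((intervalIntegrable_iff_integrableOn_Ioc_of_le (by positivity)).1 hii).const_mul _
    have hle : ∫ z in Set.Ioc 0 (u / 2), -(8 * ε / u ^ 3) * z ^ (1 - α) ≤ ∫ z in Set.Ioc 0 (u / 2), f z := by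
      refine setIntegral_mono_on hi1 hfA measurableSet_Ioc ?_
      intro z hz
      have hz0 : 0 < z := hz.1
      have := second_diff_aux g g' g'' hg hg' u z (8 * ε / u ^ 3) hz0.le (by
        intro v hv
        have hv1 := (abs_le.1 hv).1
        have hv2 : u / 2 ≤ v := by linarith [hz.2]
        have hv0 : 0 < v := by linarith
        have h3 := hN2 v (by linarith)
        have h4 : (u / 2) ^ 3 ≤ v ^ 3 := by gcongr
        have h5 : -(ε / v ^ 3) ≤ g'' v := by
          rw [← neg_div, div_le_iff₀ (by positivity)]; linarith
        have h6 : ε / v ^ 3 ≤ 8 * ε / u ^ 3 := by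
          rw [div_le_div_iff₀ (by positivity) (by positivity)]
          nlinarith
        linarith)
      have e : z ^ (1 - α) = z ^ 2 * z ^ (-(1 + α)) := by
        rw [← Real.rpow_natCast, ← Real.rpow_add hz0]; congr 1; push_cast; ring
      rw [e, ← mul_assoc]
      exact mul_le_mul_of_nonneg_right this (by positivity)
    refine le_trans ?_ hle
    rw [integral_const_mul, ← intervalIntegral.integral_of_le (by positivity), integral_rpow (Or.inl (by linarith)),
      Real.zero_rpow (by linarith), sub_zero]
    have h1 : (u / 2) ^ (1 - α + 1) / (1 - α + 1) ≤ u ^ (1 - α + 1) := by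
      refine (div_le_self (by positivity) (by linarith)).trans ?_
      exact Real.rpow_le_rpow (by positivity) (by linarith) (by linarith)
    have h2 : u ^ (1 - α + 1) = u ^ 3 * u ^ (-(1 + α)) := by
      rw [← Real.rpow_natCast, ← Real.rpow_add hu0]; congr 1; push_cast; ring
    rw [h2] at h1
    have h3 : 8 * ε / u ^ 3 * ((u / 2) ^ (1 - α + 1) / (1 - α + 1)) ≤ 8 * ε / u ^ 3 * (u ^ 3 * u ^ (-(1 + α))) :=
      mul_le_mul_of_nonneg_left h1 (by positivity)
    have h4 : 8 * ε / u ^ 3 * (u ^ 3 * u ^ (-(1 + α))) = 8 * ε * u ^ (-(1 + α)) := by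
      field_simp
    linarith
  have hB : c0 / 4 * u ^ (-(1 + α)) - 4 * ε / α * u ^ (-(1 + α)) ≤ ∫ z in Set.Ioi (u / 2), f z := by
    have i1 : IntegrableOn (fun z : ℝ => z ^ (-(1 + α))) (Set.Ioi (u / 2)) :=
      integrableOn_Ioi_rpow_of_lt (by linarith) (by positivity)
    have i2' : IntegrableOn (fun z => g (u - z) * (2 * u) ^ (-(1 + α))) (Set.Ioc (u - 1) (u + 1)) :=
      (Continuous.integrableOn_Icc (by fun_prop)).mono_set Set.Ioc_subset_Icc_self
    have i2 : Integrable (Set.indicator (Set.Ioc (u - 1) (u + 1)) (fun z => g (u - z) * (2 * u) ^ (-(1 + α)))) :=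
      (integrable_indicator_iff measurableSet_Ioc).2 i2'
    have hle : ∫ z in Set.Ioi (u / 2), (Set.indicator (Set.Ioc (u - 1) (u + 1))
          (fun z => g (u - z) * (2 * u) ^ (-(1 + α))) z - (2 * ε / u) * z ^ (-(1 + α)))
        ≤ ∫ z in Set.Ioi (u / 2), f z := by
      refine setIntegral_mono_on (i2.integrableOn.sub (i1.const_mul _)) hfB measurableSet_Ioi ?_
      intro z hz
      have hz : u / 2 < z := hz
      have hz0 : 0 < z := by linarith
      have h1 : g u ≤ ε / u := by
        rw [le_div_iff₀ hu0]; linarith [hN1 u huN1]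
      have hw : 0 < z ^ (-(1 + α)) := by positivity
      have h2 : Set.indicator (Set.Ioc (u - 1) (u + 1))
          (fun z => g (u - z) * (2 * u) ^ (-(1 + α))) z ≤ g (u - z) * z ^ (-(1 + α)) := by
        refine Set.indicator_apply_le' ?_ ?_
        · intro hm
          refine mul_le_mul_of_nonneg_left ?_ (hpos _).le
          exact Real.rpow_le_rpow_of_nonpos hz0 (by linarith [hm.2]) (by linarith)
        · intro _
          exact mul_nonneg (hpos _).le hw.le
      have h3 : 0 ≤ g (u + z) * z ^ (-(1 + α)) := mul_nonneg (hpos _).le hw.le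
      have h4 : g u * z ^ (-(1 + α)) ≤ ε / u * z ^ (-(1 + α)) := mul_le_mul_of_nonneg_right h1 hw.le
      have h5 : 2 * ε / u = 2 * (ε / u) := by ring
      simp only [hf, h5]
      nlinarith
    refine le_trans ?_ hle
    rw [integral_sub i2.integrableOn (i1.const_mul _), integral_const_mul, integral_Ioi_rpow_of_lt (by linarith) (by positivity),
      setIntegral_indicator measurableSet_Ioc, Set.inter_eq_right.2 (fun z hz => by
        have := hz.1
        show u / 2 < z
        linarith), ← intervalIntegral.integral_of_le (by linarith), intervalIntegral.integral_mul_const,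
      intervalIntegral.integral_comp_sub_left (fun x => g x) u]
    have a1 : u - (u + 1) = -1 := by ring
    have a2 : u - (u - 1) = 1 := by ring
    rw [a1, a2, ← hc0]
    have b1 : (1 / 4 : ℝ) ≤ 2 ^ (-(1 + α)) := by
      have : (2 : ℝ) ^ (-2 : ℝ) ≤ 2 ^ (-(1 + α)) := Real.rpow_le_rpow_of_exponent_le (by norm_num) (by linarith)
      refine le_trans (le_of_eq ?_) this
      rw [Real.rpow_neg (by norm_num)]; norm_num
    have b2 : (2 * u) ^ (-(1 + α)) = 2 ^ (-(1 + α)) * u ^ (-(1 + α)) := Real.mul_rpow (by norm_num) hu0.le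
    have b3 : c0 / 4 * u ^ (-(1 + α)) ≤ c0 * (2 * u) ^ (-(1 + α)) := by
      rw [b2]
      have : 0 < c0 * u ^ (-(1 + α)) := by positivity
      nlinarith
    have d1 : (u / 2) ^ (-(1 + α) + 1) ≤ 2 * u ^ (-α) := by
      have : -(1 + α) + 1 = -α := by ring
      rw [this, Real.div_rpow hu0.le (by norm_num), Real.rpow_neg (x := 2) (by norm_num), div_inv_eq_mul, mul_comm]
      have : (2 : ℝ) ^ α ≤ 2 ^ (1 : ℝ) := Real.rpow_le_rpow_of_exponent_le (by norm_num) hα1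
      rw [Real.rpow_one] at this
      gcongr
    have d2 : u ^ (-α) = u * u ^ (-(1 + α)) := by
      nth_rewrite 2 [← Real.rpow_one u]
      rw [← Real.rpow_add hu0]; congr 1; ring
    have d3 : 2 * ε / u * (-(u / 2) ^ (-(1 + α) + 1) / (-(1 + α) + 1)) ≤ 4 * ε / α * u ^ (-(1 + α)) := by
      have e1 : -(u / 2) ^ (-(1 + α) + 1) / (-(1 + α) + 1) = (u / 2) ^ (-(1 + α) + 1) / α := by
        rw [show -(1 + α) + 1 = -α by ring, neg_div_neg_eq]
      rw [e1]
      have : 2 * ε / u * ((u / 2) ^ (-(1 + α) + 1) / α) ≤ 2 * ε / u * (2 * u ^ (-α) / α) := by gcongr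
      refine this.trans (le_of_eq ?_)
      rw [d2]; field_simp; ring
    linarith
  rw [hsplit]
  have hw : 0 < u ^ (-(1 + α)) := by positivity
  have : ε * (8 + 4 / α) * u ^ (-(1 + α)) = c0 / 8 * u ^ (-(1 + α)) := by rw [hε2]
  have e4 : 4 * ε / α = ε * (4 / α) := by ring
  rw [e4] at hB
  nlinarith

lemma fracC_pos (α : ℝ) (hα : α ∈ Set.Ioc (0 : ℝ) 1) : 0 < fracC α := by
  obtain ⟨h0, h1⟩ := hα
  have hG : Real.Gamma (-α / 2) ≠ 0 := by
    refine Real.Gamma_ne_zero fun m hm => ?_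
    rcases Nat.eq_zero_or_pos m with rfl | hm0
    · simp at hm; linarith
    · have : (1 : ℝ) ≤ m := by exact_mod_cast hm0
      linarith
  have := Real.Gamma_pos_of_pos (show 0 < (1 + α) / 2 by linarith)
  unfold fracC
  have := abs_pos.2 hG
  positivity

theorem stmt_14 (α : ℝ) (hα : α ∈ Set.Ioc (0 : ℝ) 1)
    (V : ℝ → ℝ) (hV : ContDiff ℝ 2 V)
    (hsym : ∀ x : ℝ, V x = V (-x))
    (hL1 : Integrable (fun x => Real.exp (-(V x))))
    (hCb2 : ∃ M : ℝ, ∀ x : ℝ, Real.exp (-(V x)) ≤ M ∧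
      |deriv (fun y => Real.exp (-(V y))) x| ≤ M ∧
      |deriv (deriv (fun y => Real.exp (-(V y)))) x| ≤ M)
    (hlim : ∃ M R : ℝ, ∀ x : ℝ, R ≤ |x| →
      |x| ^ 3 * Real.exp (-(V x)) * |(deriv V x) ^ 2 - deriv (deriv V) x| ≤ M)
    (hxe : Tendsto (fun x => x * Real.exp (-(V x))) atTop (nhds 0))
    (hliminf : ∀ ε : ℝ, 0 < ε → ∀ᶠ x in atTop,
      -ε ≤ x ^ 3 * Real.exp (-(V x)) * ((deriv V x) ^ 2 - deriv (deriv V) x)) :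
    ∃ c₁ c₂ r₁ : ℝ, 0 < c₁ ∧ 0 < c₂ ∧ 1 < r₁ ∧ ∀ x : ℝ,
      (|x| ≤ r₁ → x * fracDrift1 α V x ≤ c₁) ∧
      (r₁ < |x| → x * fracDrift1 α V x ≤
        -c₂ * Real.exp (V x) * |x| ^ (-(1 + α)) * x ^ 2) := by
  have hα' := hα
  obtain ⟨hα0, hα1⟩ := hα'
  set g : ℝ → ℝ := fun y => Real.exp (-(V y)) with hgdef
  have hVd : ∀ x, HasDerivAt V (deriv V x) x := fun x =>
    ((hV.differentiable (by norm_num)) x).hasDerivAt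
  have hV1 : ContDiff ℝ 1 (deriv V) := by
    have : ContDiff ℝ (1 + 1) V := by simpa [one_add_one_eq_two] using hV
    exact (contDiff_succ_iff_deriv.1 this).2.2
  have hVd2 : ∀ x, HasDerivAt (deriv V) (deriv (deriv V) x) x := fun x =>
    ((hV1.differentiable (by norm_num)) x).hasDerivAt
  obtain ⟨g', hg'def⟩ : ∃ g' : ℝ → ℝ, g' = fun x => Real.exp (-(V x)) * -(deriv V x) := ⟨_, rfl⟩
  obtain ⟨g'', hg''def⟩ : ∃ g'' : ℝ → ℝ,
    g'' = fun x => Real.exp (-(V x)) * ((deriv V x) ^ 2 - deriv (deriv V) x) := ⟨_, rfl⟩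
  have hg : ∀ x, HasDerivAt g (g' x) x := fun x => by
    rw [hg'def]; exact (hVd x).neg.exp
  have hg' : ∀ x, HasDerivAt g' (g'' x) x := fun x => by
    rw [hg'def, hg''def]
    have := (hVd x).neg.exp.mul (hVd2 x).neg
    refine HasDerivAt.congr_deriv this ?_
    simp only [Pi.neg_apply]
    ring
  have hdg : deriv g = g' := funext fun x => (hg x).deriv
  have hdg' : deriv g' = g'' := funext fun x => (hg' x).deriv
  have hpos : ∀ x, 0 < g x := fun x => Real.exp_pos _
  have heven : ∀ x, g (-x) = g x := fun x => by simp only [hgdef]; rw [← hsym x]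
  have hodd : ∀ x, g' (-x) = -g' x := fun x => by
    have h1 := (hg (-x)).comp x (hasDerivAt_neg x)
    have h2 : g ∘ Neg.neg = g := funext heven
    have h3 := (h1.congr_of_eventuallyEq (f₁ := g) (by
      refine Eventually.of_forall fun y => (heven y).symm)).unique (hg x)
    linarith
  obtain ⟨M, hM⟩ := hCb2
  rw [hdg, hdg'] at hM
  obtain ⟨M', R, hM'⟩ := hlim
  obtain ⟨K, hK⟩ : ∃ K : ℝ, ∀ x, |g'' x| ≤ K * (1 + x ^ 2)⁻¹ := by
    have hM0 : 0 ≤ M := (abs_nonneg _).trans (hM 0).2.2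
    refine ⟨M * (1 + (max R 1) ^ 2) + 2 * |M'|, fun x => ?_⟩
    rw [← div_eq_mul_inv, le_div_iff₀ (by positivity)]
    rcases le_total |x| (max R 1) with h | h
    · have h1 : x ^ 2 ≤ (max R 1) ^ 2 := by
        rw [← sq_abs]; gcongr
      have h2 : |g'' x| * (1 + x ^ 2) ≤ M * (1 + (max R 1) ^ 2) := by
        have := (hM x).2.2
        gcongr
      linarith [abs_nonneg M']
    · have hx1 : 1 ≤ |x| := (le_max_right _ _).trans h
      have h1 := hM' x ((le_max_left _ _).trans h)
      have h2 : |g'' x| = Real.exp (-(V x)) * |(deriv V x) ^ 2 - deriv (deriv V) x| := by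
        rw [hg''def]; simp only []
        rw [abs_mul, abs_of_pos (Real.exp_pos _)]
      have h3 : |x| ^ 3 * |g'' x| ≤ |M'| := by
        rw [h2, ← mul_assoc]; exact h1.trans (le_abs_self _)
      have h4 : 1 + x ^ 2 ≤ 2 * |x| ^ 3 := by
        rw [← sq_abs x]
        have : 1 ≤ |x| ^ 2 := one_le_pow₀ hx1
        nlinarith
      have h5 : |g'' x| * (1 + x ^ 2) ≤ |g'' x| * (2 * |x| ^ 3) := by gcongr
      have : 0 ≤ M * (1 + (max R 1) ^ 2) := by positivity
      linarith
  have hl : ∀ ε : ℝ, 0 < ε → ∀ᶠ x in atTop, -ε ≤ x ^ 3 * g'' x := by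
    intro ε hε
    filter_upwards [hliminf ε hε] with x hx
    rw [hg''def]
    simpa [mul_assoc] using hx
  have hJ := jI_int α hα g g' g'' hg hg' hpos hL1 K hK
  have hT := jI_total α hα g g' g'' hg hg' hpos hL1 K hK
  obtain ⟨c, N, hc, hN, hlow⟩ := jI_lower α hα g g' g'' hg hg' hpos hxe hl
  obtain ⟨L, hL⟩ : ∃ L : ℝ → ℝ, L = fun u => ∫ z, jI α g g' u z := ⟨_, rfl⟩
  have hLi : Integrable L := by rw [hL]; exact hJ.integral_prod_left
  have hLT : ∫ u, L u = 0 := by rw [hL]; exact hT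
  have hLeven : ∀ u, L (-u) = L u := by
    intro u
    rw [hL]
    simp only []
    rw [← integral_neg_eq_self]
    congr 1
    ext z
    unfold jI
    rw [hodd, heven, abs_neg, show -u + -z = -(u + z) by ring, heven]
    ring
  have hLlow : ∀ᵐ u, N < u → c * u ^ (-(1 + α)) ≤ L u := by
    filter_upwards [hJ.prod_right_ae] with u hu huN
    rw [hL]
    exact hlow u huN hu
  have hC := fracC_pos α hα
  have hb : ∀ x, fracDrift1 α V x = fracC α * Real.exp (V x) * ∫ u in Set.Iic x, L u := by
    intro x
    unfold fracDrift1
    have : ∀ u, fracLap1 α (fun y => Real.exp (-(V y))) u = -fracC α * L u := by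
      intro u
      unfold fracLap1
      rw [hL, hdg, neg_mul]
      rfl
    simp only [this]
    rw [integral_const_mul]
    ring
  -- tail
  have htail : ∀ x, N < x → c / α * x ^ (-α) ≤ ∫ u in Set.Ioi x, L u := by
    intro x hx
    have hx0 : 0 < x := by linarith
    have h1 := setIntegral_mono_on_ae (μ := volume) (s := Set.Ioi x)
      ((integrableOn_Ioi_rpow_of_lt (a := -(1 + α)) (by linarith) hx0).const_mul c)
      hLi.integrableOn measurableSet_Ioi (by
        filter_upwards [hLlow] with u hu hux
        exact hu (lt_trans hx hux))
    rw [integral_const_mul, integral_Ioi_rpow_of_lt (by linarith) hx0,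
      show -(1 + α) + 1 = -α by ring, neg_div_neg_eq] at h1
    refine le_trans (le_of_eq ?_) h1
    ring
  have hneg : ∀ x, ∫ u in Set.Iic (-x), L u = ∫ u in Set.Ioi x, L u := by
    intro x
    have := integral_comp_neg_Iic (-x) L
    rw [neg_neg] at this
    rw [← this]
    simp only [hLeven]
  have hcompl : ∀ x, ∫ u in Set.Iic x, L u = -∫ u in Set.Ioi x, L u := by
    intro x
    have := integral_add_compl (measurableSet_Iic (a := x)) hLi
    rw [Set.compl_Iic, hLT] at this
    linarith
  have hVc : Continuous (fun x => |x * fracC α * Real.exp (V x)|) := by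
    have := hV.continuous
    fun_prop
  obtain ⟨B, hB⟩ := (isCompact_Icc (a := -N) (b := N)).exists_bound_of_continuousOn hVc.continuousOn
  refine ⟨|B| * (∫ u, |L u|) + 1, fracC α * (c / α), N, ?_, by positivity, hN, ?_⟩
  · have : 0 ≤ ∫ u, |L u| := integral_nonneg fun _ => abs_nonneg _
    positivity
  intro x
  constructor
  · intro hx
    rw [hb]
    have h1 : |∫ u in Set.Iic x, L u| ≤ ∫ u, |L u| :=
      (abs_integral_le_integral_abs).trans
        (setIntegral_le_integral hLi.abs (Eventually.of_forall fun _ => abs_nonneg _))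
    have h2 : |x * fracC α * Real.exp (V x)| ≤ |B| := by
      have := hB x (abs_le.1 hx)
      rw [Real.norm_eq_abs, abs_abs] at this
      exact this.trans (le_abs_self _)
    calc x * (fracC α * Real.exp (V x) * ∫ u in Set.Iic x, L u)
        = (x * fracC α * Real.exp (V x)) * ∫ u in Set.Iic x, L u := by ring
      _ ≤ |(x * fracC α * Real.exp (V x)) * ∫ u in Set.Iic x, L u| := le_abs_self _
      _ = |x * fracC α * Real.exp (V x)| * |∫ u in Set.Iic x, L u| := abs_mul _ _
      _ ≤ |B| * ∫ u, |L u| := by gcongr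
      _ ≤ _ := by linarith
  · intro hx
    have hx0 : 0 < |x| := by linarith
    have ht := htail |x| hx
    have key : x * fracDrift1 α V x =
        -(fracC α * Real.exp (V x) * |x| * ∫ u in Set.Ioi |x|, L u) := by
      rw [hb]
      rcases abs_choice x with h | h
      · rw [hcompl, h]; ring
      · have : Set.Iic x = Set.Iic (-|x|) := by rw [h, neg_neg]
        rw [this, hneg]
        have : x = -|x| := by rw [h, neg_neg]
        generalize ∫ u in Set.Ioi |x|, L u = q
        rw [h]; ring
    rw [key]
    have e : |x| ^ (-(1 + α)) * x ^ 2 = |x| * |x| ^ (-α) := by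
      rw [← sq_abs, ← Real.rpow_natCast]
      nth_rewrite 3 [← Real.rpow_one |x|]
      rw [← Real.rpow_add hx0, ← Real.rpow_add hx0]; congr 1; push_cast; ring
    have h1 : fracC α * Real.exp (V x) * |x| * (c / α * |x| ^ (-α)) ≤
        fracC α * Real.exp (V x) * |x| * ∫ u in Set.Ioi |x|, L u :=
      mul_le_mul_of_nonneg_left ht (by positivity)
    have h2 : -(fracC α * (c / α)) * Real.exp (V x) * |x| ^ (-(1 + α)) * x ^ 2 =
        -(fracC α * Real.exp (V x) * |x| * (c / α * |x| ^ (-α))) := by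
      rw [mul_assoc _ (|x| ^ (-(1 + α))), e]; ring
    rw [h2]
    linarith
end

section
/- Let α ∈ (0,1] and let V ∈ C²(ℝ) be a symmetric function (V(x) = V(−x) for all x ∈ ℝ) such that e^{−V} ∈ L¹(ℝ; dx) ∩ C_b²(ℝ). Suppose that limsup_{|x|→∞} |x|³ e^{−V(x)} |V'(x)² − V''(x)| < ∞ and that lim_{x→∞} x e^{−V(x)} = 0. Then: (i) there exist constants c₁ > 0 and R > 0 such that −(−Δ)^{α/2} e^{−V(x)} ≤ c₁ x^{−(1+α)} for all x ≥ R; and (ii) there exist constants c₀ > 0 and r₁ > 1 such that b(x) ≥ −c₀ e^{V(x)} |x|^{−α} for all x ∈ ℝ with |x| ≥ r₁. -/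
open MeasureTheory Real Filter

namespace FracAux

/-- Truncated Levy weight. -/
noncomputable def w (α z : ℝ) : ℝ := min 1 (z ^ 2) * |z| ^ (-(1 + α))

lemma w_nonneg (α z : ℝ) : 0 ≤ w α z := by unfold w; positivity

lemma w_neg (α z : ℝ) : w α (-z) = w α z := by simp [w]

lemma w_measurable (α : ℝ) : Measurable (w α) := by
  unfold w; fun_prop

lemma w_integrable (α : ℝ) (h0 : 0 < α) (h1 : α ≤ 1) : Integrable (w α) := by
  have hpos : IntegrableOn (w α) (Set.Ioi 0) := by
    have : Set.Ioi (0:ℝ) = Set.Ioc 0 1 ∪ Set.Ioi 1 := by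
      rw [Set.Ioc_union_Ioi_eq_Ioi zero_le_one]
    rw [this]
    refine IntegrableOn.union ?_ ?_
    · have h : IntegrableOn (fun z : ℝ => z ^ (1 - α)) (Set.Ioc 0 1) := by
        have := intervalIntegral.intervalIntegrable_rpow' (a := 0) (b := 1) (r := 1 - α)
          (by linarith)
        rwa [intervalIntegrable_iff_integrableOn_Ioc_of_le zero_le_one] at this
      refine h.congr_fun (fun z hz => ?_) measurableSet_Ioc
      have hz0 : 0 < z := hz.1
      have hz1 : z ≤ 1 := hz.2
      simp only [w]
      rw [min_eq_right (by nlinarith), abs_of_pos hz0, ← Real.rpow_natCast, ← Real.rpow_add hz0]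
      congr 1
      push_cast; ring
    · have h : IntegrableOn (fun z : ℝ => z ^ (-(1 + α))) (Set.Ioi 1) :=
        integrableOn_Ioi_rpow_of_lt (by linarith) one_pos
      refine h.congr_fun (fun z hz => ?_) measurableSet_Ioi
      have hz1 : 1 < z := hz
      simp only [w]
      rw [min_eq_left (by nlinarith), abs_of_pos (by linarith), one_mul]
  have hF : Integrable ((Set.Ioi (0:ℝ)).indicator (w α)) :=
    (integrable_indicator_iff measurableSet_Ioi).2 hpos
  refine (hF.add hF.comp_neg).congr (Eventually.of_forall fun z => ?_)
  simp only [Pi.add_apply]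
  rcases lt_trichotomy z 0 with h | h | h
  · rw [Set.indicator_of_notMem (by simp [h.le]), Set.indicator_of_mem (by simpa using h), w_neg,
      zero_add]
  · subst h; simp [w]
  · rw [Set.indicator_of_mem (by simpa using h), Set.indicator_of_notMem (by simp [h.le]), add_zero]

lemma le_w {α z D a b : ℝ} (h1 : |z| ≤ 1 → D ≤ a * z ^ 2) (h2 : 1 < |z| → D ≤ b) 
    (ha : 0 ≤ a) (hb : 0 ≤ b) :
    D * |z| ^ (-(1 + α)) ≤ (a + b) * w α z := by
  unfold w
  rw [← mul_assoc]
  refine mul_le_mul_of_nonneg_right ?_ (by positivity)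
  rcases le_or_gt |z| 1 with h | h
  · have hz : z ^ 2 ≤ 1 := by rw [← sq_abs]; nlinarith [abs_nonneg z]
    rw [min_eq_right hz]
    nlinarith [h1 h, sq_nonneg z, mul_nonneg hb (sq_nonneg z)]
  · have hz : 1 ≤ z ^ 2 := by rw [← sq_abs]; nlinarith [abs_nonneg z]
    rw [min_eq_left hz]
    linarith [h2 h]

lemma taylor {g : ℝ → ℝ} (hg : ContDiff ℝ 2 g) {x z B : ℝ}
    (hB : ∀ y, |y - x| ≤ |z| → |deriv (deriv g) y| ≤ B) :
    |g (x + z) - g x - deriv g x * z| ≤ B * z ^ 2 := by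
  have hd : Differentiable ℝ g := hg.differentiable (by norm_num)
  have hd1 : ContDiff ℝ 1 (deriv g) := by
    have : ContDiff ℝ (1 + 1) g := by simpa [one_add_one_eq_two] using hg
    exact (contDiff_succ_iff_deriv.1 this).2.2
  have hd2 : Differentiable ℝ (deriv g) := hd1.differentiable (by norm_num)
  have hconv : Convex ℝ (Metric.closedBall x |z|) := convex_closedBall x |z|
  have hx : x ∈ Metric.closedBall x |z| := by simp
  have hxz : x + z ∈ Metric.closedBall x |z| := by simp [Real.dist_eq]
  have hBn : 0 ≤ B := le_trans (abs_nonneg _) (hB x (by simp))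
  have h1 : ∀ y ∈ Metric.closedBall x |z|, ‖deriv g y - deriv g x‖ ≤ B * |z| := by
    intro y hy
    have := hconv.norm_image_sub_le_of_norm_deriv_le (f := deriv g) (C := B)
      (fun t _ => hd2 t) (fun t ht => hB t (by simpa [Real.dist_eq] using ht)) hx hy
    refine this.trans ?_
    gcongr
    simpa [Real.dist_eq] using hy
  have hder : ∀ y, HasDerivAt (fun y => g y - deriv g x * y) (deriv g y - deriv g x) y := by
    intro y
    have h := (hd y).hasDerivAt.sub ((hasDerivAt_id y).const_mul (deriv g x))
    rw [mul_one] at h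
    exact h
  have := hconv.norm_image_sub_le_of_norm_hasDerivWithin_le
    (fun t _ => (hder t).hasDerivWithinAt) h1 hx hxz
  calc |g (x + z) - g x - deriv g x * z|
      = ‖g (x + z) - deriv g x * (x + z) - (g x - deriv g x * x)‖ := by
        rw [Real.norm_eq_abs]; congr 1; ring
    _ ≤ B * |z| * ‖x + z - x‖ := this
    _ = B * z ^ 2 := by
        rw [add_sub_cancel_left, Real.norm_eq_abs, mul_assoc, abs_mul_abs_self]; ring

/-- symmetric second difference -/
def sd (g : ℝ → ℝ) (x z : ℝ) : ℝ := g (x + z) + g (x - z) - 2 * g x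

lemma sd_le {g : ℝ → ℝ} (hg : ContDiff ℝ 2 g) {x z B : ℝ}
    (hB : ∀ y, |y - x| ≤ |z| → |deriv (deriv g) y| ≤ B) :
    |sd g x z| ≤ 2 * B * z ^ 2 := by
  have h1 := taylor hg hB
  have h2 := taylor hg (z := -z) (by simpa using hB)
  have : sd g x z = (g (x + z) - g x - deriv g x * z) + (g (x + -z) - g x - deriv g x * (-z)) := by
    simp only [sd, sub_eq_add_neg]; ring
  rw [this]
  refine (abs_add_le _ _).trans ?_
  nlinarith

lemma sd_le' {g : ℝ → ℝ} (h0 : ∀ x, 0 ≤ g x) (x z : ℝ) :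
    |sd g x z| ≤ g (x + z) + g (x - z) + 2 * g x := by
  unfold sd
  rw [abs_le]; constructor <;> linarith [h0 (x + z), h0 (x - z), h0 x]

/-- symmetrised operator -/
noncomputable def A (α : ℝ) (g : ℝ → ℝ) (x : ℝ) : ℝ := ∫ z, sd g x z * |z| ^ (-(1 + α))

lemma fracLap_eq {α : ℝ} (hα0 : 0 < α) (hα1 : α ≤ 1) {g : ℝ → ℝ} (hg : ContDiff ℝ 2 g) {M : ℝ}
    (hM : ∀ x, |g x| ≤ M) (hM2 : ∀ x, |deriv (deriv g) x| ≤ M) (x : ℝ) :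
    fracLap1 α g x = -(fracC α * (A α g x / 2)) := by
  have hM0 : 0 ≤ M := (abs_nonneg _).trans (hM 0)
  unfold fracLap1
  congr 2
  set f : ℝ → ℝ := fun z =>
    (g (x + z) - g x - deriv g x * z * (if |z| ≤ 1 then 1 else 0)) * |z| ^ (-(1 + α)) with hf
  have hgm : Measurable g := hg.continuous.measurable
  have hfi : Integrable f := by
    refine ((w_integrable α hα0 hα1).const_mul (M + 2 * M)).mono' ?_ (Eventually.of_forall fun z => ?_)
    · refine Measurable.aestronglyMeasurable ?_
      refine Measurable.mul ?_ (by fun_prop)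
      refine Measurable.sub (by fun_prop) ?_
      refine Measurable.mul (by fun_prop) ?_
      exact Measurable.ite (measurableSet_le (by fun_prop) (by fun_prop)) measurable_const
        measurable_const
    · rw [hf, Real.norm_eq_abs, abs_mul, abs_of_nonneg (a := |z| ^ (-(1 + α))) (by positivity)]
      refine le_w (fun h => ?_) (fun h => ?_) hM0 (by linarith)
      · rw [if_pos h, mul_one]
        exact taylor hg (fun y _ => hM2 y)
      · rw [if_neg h.not_ge, mul_zero, sub_zero]
        refine (abs_sub _ _).trans ?_
        linarith [hM (x + z), hM x]
  have h1 : ∫ z, f z = ∫ z, f (-z) := (integral_neg_eq_self f volume).symm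
  have h2 : (∫ z, f z) + ∫ z, f (-z) = A α g x := by
    rw [← integral_add hfi hfi.comp_neg]
    unfold A
    congr 1
    ext z
    simp only [hf, sd, abs_neg, sub_eq_add_neg]
    ring
  change ∫ z, f z = _
  linarith

lemma A_even {α : ℝ} {g : ℝ → ℝ} (he : ∀ x, g (-x) = g x) (x : ℝ) : A α g (-x) = A α g x := by
  unfold A
  congr 1
  ext z
  have h1 : g (-x + z) = g (x - z) := by rw [← he]; congr 1; ring
  have h2 : g (-x - z) = g (x + z) := by rw [← he]; congr 1; ring
  simp only [sd, h1, h2, he]; ring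

lemma dd_bound {g : ℝ → ℝ} {M M' R : ℝ} (hM2 : ∀ x, |deriv (deriv g) x| ≤ M)
    (hdec : ∀ x, R ≤ |x| → |x| ^ 3 * |deriv (deriv g) x| ≤ M') :
    ∃ C, 0 ≤ C ∧ ∀ x y, |y - x| ≤ 1 → |deriv (deriv g) y| ≤ C * (1 + x ^ 2)⁻¹ := by
  have hM0 : 0 ≤ M := (abs_nonneg _).trans (hM2 0)
  set R1 := max R 1 with hR1
  have hM' : 0 ≤ M' := by
    refine le_trans ?_ (hdec (|R|) (by simp [le_abs_self]))
    positivity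
  refine ⟨3 * (M * (1 + R1 ^ 2) + 2 * M'), by positivity, fun x y hxy => ?_⟩
  rw [← div_eq_mul_inv, le_div_iff₀ (by positivity)]
  have hx : 1 + x ^ 2 ≤ 3 * (1 + y ^ 2) := by
    have := abs_le.1 hxy
    nlinarith [sq_nonneg (y - x), sq_nonneg (y + (y - x))]
  have key : |deriv (deriv g) y| * (1 + y ^ 2) ≤ M * (1 + R1 ^ 2) + 2 * M' := by
    rcases le_or_gt R1 |y| with h | h
    · have hy1 : 1 ≤ |y| := (le_max_right _ _).trans h
      have := hdec y ((le_max_left _ _).trans h)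
      have h3 : 1 + y ^ 2 ≤ 2 * |y| ^ 3 := by
        rw [← sq_abs]; nlinarith [sq_nonneg |y|, mul_nonneg (sq_nonneg |y|) (sub_nonneg.2 hy1)]
      have h4 : 0 ≤ M * (1 + R1 ^ 2) := by positivity
      nlinarith [mul_le_mul_of_nonneg_left h3 (abs_nonneg (deriv (deriv g) y))]
    · have h3 : y ^ 2 ≤ R1 ^ 2 := by rw [← sq_abs]; gcongr
      have : |deriv (deriv g) y| * (1 + y ^ 2) ≤ M * (1 + R1 ^ 2) :=
        mul_le_mul (hM2 y) (by linarith) (by positivity) hM0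
      linarith
  nlinarith [mul_le_mul_of_nonneg_left hx (abs_nonneg (deriv (deriv g) y))]

lemma prod_integrable {α : ℝ} (hα0 : 0 < α) (hα1 : α ≤ 1) {g : ℝ → ℝ} (hg : ContDiff ℝ 2 g)
    (h0 : ∀ x, 0 ≤ g x) (hi : Integrable g) {C : ℝ} (hC0 : 0 ≤ C)
    (hC : ∀ x y, |y - x| ≤ 1 → |deriv (deriv g) y| ≤ C * (1 + x ^ 2)⁻¹) :
    Integrable (Function.uncurry fun x z => sd g x z * |z| ^ (-(1 + α)))
      ((volume : Measure ℝ).prod volume) := by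
  have hw := w_integrable α hα0 hα1
  have hgm : Measurable g := hg.continuous.measurable
  have i1 : Integrable (fun p : ℝ × ℝ => (2 * C * (1 + p.1 ^ 2)⁻¹ + 2 * g p.1) * w α p.2)
      ((volume : Measure ℝ).prod volume) :=
    ((integrable_inv_one_add_sq.const_mul (2 * C)).add (hi.const_mul 2)).mul_prod hw
  have i2 : Integrable (fun p : ℝ × ℝ => w α p.2 * g (p.1 - p.2))
      ((volume : Measure ℝ).prod volume) := 
    hw.convolution_integrand (ContinuousLinearMap.mul ℝ ℝ) hi
  have i3 : Integrable (fun p : ℝ × ℝ => w α p.2 * g (p.1 + p.2))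
      ((volume : Measure ℝ).prod volume) := by
    have hmp : MeasurePreserving (Prod.map id Neg.neg : ℝ × ℝ → ℝ × ℝ)
        ((volume : Measure ℝ).prod volume) ((volume : Measure ℝ).prod volume) :=
      (MeasurePreserving.id volume).prod (Measure.measurePreserving_neg volume)
    have := hmp.integrable_comp_of_integrable i2
    refine this.congr (Eventually.of_forall fun p => ?_)
    simp [w_neg]
  refine ((i1.add i2).add i3).mono' ?_ (Eventually.of_forall fun p => ?_)
  · refine Measurable.aestronglyMeasurable ?_
    unfold sd
    simp only [Function.uncurry_def]
    fun_prop
  · obtain ⟨x, z⟩ := p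
    simp only [Function.uncurry_apply_pair, Pi.add_apply]
    rw [Real.norm_eq_abs, abs_mul, abs_of_nonneg (a := |z| ^ (-(1 + α))) (by positivity)]
    have hb : 0 ≤ g (x + z) + g (x - z) + 2 * g x := by linarith [h0 (x + z), h0 (x - z), h0 x]
    have := le_w (α := α) (z := z) (D := |sd g x z|) (a := 2 * (C * (1 + x ^ 2)⁻¹))
      (b := g (x + z) + g (x - z) + 2 * g x)
      (fun h => sd_le hg (fun y hy => hC x y (hy.trans h))) (fun _ => sd_le' h0 x z)
      (by positivity) hb
    linarith

lemma A_integrable {α : ℝ} {g : ℝ → ℝ} 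
    (hp : Integrable (Function.uncurry fun x z => sd g x z * |z| ^ (-(1 + α)))
      ((volume : Measure ℝ).prod volume)) : Integrable (A α g) :=
  hp.integral_prod_left

lemma A_integral {α : ℝ} {g : ℝ → ℝ} (hi : Integrable g)
    (hp : Integrable (Function.uncurry fun x z => sd g x z * |z| ^ (-(1 + α)))
      ((volume : Measure ℝ).prod volume)) : ∫ x, A α g x = 0 := by
  unfold A
  rw [integral_integral_swap hp]
  have : ∀ z : ℝ, ∫ x, sd g x z * |z| ^ (-(1 + α)) = 0 := by
    intro z
    rw [integral_mul_const]
    have h : ∫ x, sd g x z = 0 := by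
      unfold sd
      have hs : Integrable (fun x => g (x + z) + g (x - z)) :=
        (hi.comp_add_right z).add (hi.comp_sub_right z)
      rw [integral_sub hs (hi.const_mul 2),
        integral_add (hi.comp_add_right z) (hi.comp_sub_right z), integral_const_mul,
        integral_add_right_eq_self g z, integral_sub_right_eq_self g z]
      ring
    rw [h, zero_mul]
  simp only [this, integral_zero]

lemma w_scale {α x z : ℝ} (hx : 0 < x) :
    min 1 ((2 * x⁻¹ * z) ^ 2) * |z| ^ (-(1 + α)) = (x / 2) ^ (-(1 + α)) * w α (2 * x⁻¹ * z) := by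
  unfold w
  have : |z| = (x / 2) * |2 * x⁻¹ * z| := by
    rw [abs_mul, abs_of_pos (by positivity : 0 < 2 * x⁻¹)]; field_simp
  rw [this, Real.mul_rpow (by positivity) (by positivity)]
  ring

lemma A_bound {α : ℝ} (hα0 : 0 < α) (hα1 : α ≤ 1) {g : ℝ → ℝ} (hg : ContDiff ℝ 2 g)
    (h0 : ∀ x, 0 ≤ g x) (hi : Integrable g) {M' R N : ℝ}
    (hdec : ∀ x, R ≤ |x| → |x| ^ 3 * |deriv (deriv g) x| ≤ M')
    (hN : ∀ x, R ≤ x → x * g x ≤ N) :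
    ∃ C R', 0 < C ∧ 1 < R' ∧ ∀ x, R' ≤ x → |A α g x| ≤ C * x ^ (-(1 + α)) := by
  have hw := w_integrable α hα0 hα1
  have hM' : 0 ≤ M' := by
    refine le_trans ?_ (hdec (|R|) (by simp [le_abs_self]))
    positivity
  have hN0 : 0 ≤ N := le_trans (mul_nonneg (abs_nonneg R) (h0 _)) (hN |R| (le_abs_self R))
  set K := 4 * M' + 2 * N with hK
  have hK0 : 0 ≤ K := by positivity
  set W := ∫ z, w α z with hW
  set G := ∫ z, g z with hG
  have hW0 : 0 ≤ W := integral_nonneg (w_nonneg α)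
  have hG0 : 0 ≤ G := integral_nonneg h0
  refine ⟨(1 / 2 : ℝ) ^ (-(1 + α)) * (K * W / 2 + 2 * G) + 1, max (2 * R) 2, by positivity,
    lt_of_lt_of_le one_lt_two (le_max_right _ _), fun x hx => ?_⟩
  have hx2 : 2 ≤ x := (le_max_right _ _).trans hx
  have hxR : 2 * R ≤ x := (le_max_left _ _).trans hx
  have hx0 : 0 < x := by linarith
  have hxR' : R ≤ x := by linarith
  have hgx : g x ≤ N / x := by
    rw [le_div_iff₀ hx0, mul_comm]; exact hN x hxR'
  set H : ℝ → ℝ := fun z => (x / 2) ^ (-(1 + α)) *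
    ((K / x) * w α (2 * x⁻¹ * z) + (g (x + z) + g (x - z))) with hH
  have hr : (2 * x⁻¹ : ℝ) ≠ 0 := by positivity
  have e1 : Integrable (fun z => (K / x) * w α (2 * x⁻¹ * z)) :=
    (hw.comp_mul_left' hr).const_mul _
  have e2 : Integrable (fun z => g (x + z)) := hi.comp_add_left x
  have e3 : Integrable (fun z => g (x - z)) := hi.comp_sub_left x
  have e4 : Integrable (fun z => g (x + z) + g (x - z)) := e2.add e3
  have hHi : Integrable H := (e1.add e4).const_mul _
  have hbd : ∀ z, ‖sd g x z * |z| ^ (-(1 + α))‖ ≤ H z := by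
    intro z
    rw [Real.norm_eq_abs, abs_mul, abs_of_nonneg (a := |z| ^ (-(1 + α))) (by positivity)]
    simp only [hH]
    rw [mul_add, mul_left_comm, ← w_scale hx0]
    rcases le_or_gt |z| (x / 2) with h | h
    · have hz : (2 * x⁻¹ * z) ^ 2 ≤ 1 := by
        rw [← sq_abs, abs_mul, abs_of_pos (by positivity : 0 < 2 * x⁻¹)]
        refine pow_le_one₀ (by positivity) ?_
        calc 2 * x⁻¹ * |z| ≤ 2 * x⁻¹ * (x / 2) := by gcongr
          _ = 1 := by field_simp
      rw [min_eq_right hz]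
      have hs : |sd g x z| ≤ 2 * (8 * M' / x ^ 3) * z ^ 2 := by
        refine sd_le hg (fun y hy => ?_)
        have hy' := abs_le.1 (hy.trans h)
        have hy2 : x / 2 ≤ y := by linarith
        have hyp : 0 < y := by linarith
        have := hdec y (by rw [abs_of_pos hyp]; linarith)
        rw [abs_of_pos hyp] at this
        rw [le_div_iff₀ (by positivity)]
        have h3 : (x / 2) ^ 3 ≤ y ^ 3 := by gcongr
        have h4 := mul_le_mul_of_nonneg_right h3 (abs_nonneg (deriv (deriv g) y))
        nlinarith
      have hs2 : |sd g x z| ≤ K / x * (2 * x⁻¹ * z) ^ 2 := by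
        refine hs.trans ?_
        have : K / x * (2 * x⁻¹ * z) ^ 2 - 2 * (8 * M' / x ^ 3) * z ^ 2 = 8 * N / x ^ 3 * z ^ 2 := by
          rw [hK]; field_simp; ring
        have h5 : 0 ≤ 8 * N / x ^ 3 * z ^ 2 := by positivity
        linarith
      have h6 : 0 ≤ (x / 2) ^ (-(1 + α)) * (g (x + z) + g (x - z)) :=
        mul_nonneg (by positivity) (add_nonneg (h0 _) (h0 _))
      have := mul_le_mul_of_nonneg_right hs2 (by positivity : 0 ≤ |z| ^ (-(1 + α)))
      linarith
    · have hz : 1 ≤ (2 * x⁻¹ * z) ^ 2 := by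
        rw [← sq_abs, abs_mul, abs_of_pos (by positivity : 0 < 2 * x⁻¹)]
        refine one_le_pow₀ ?_
        calc 1 = 2 * x⁻¹ * (x / 2) := by field_simp
          _ ≤ 2 * x⁻¹ * |z| := by gcongr
      rw [min_eq_left hz, one_mul]
      have h7 : |z| ^ (-(1 + α)) ≤ (x / 2) ^ (-(1 + α)) :=
        Real.rpow_le_rpow_of_nonpos (by positivity) h.le (by linarith)
      have h8 : 2 * g x ≤ K / x := by
        have : K / x = 4 * M' / x + 2 * (N / x) := by rw [hK]; ring
        have h9 : 0 ≤ 4 * M' / x := by positivity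
        linarith
      have h9 : |sd g x z| ≤ K / x + (g (x + z) + g (x - z)) := by
        linarith [sd_le' h0 x z]
      calc |sd g x z| * |z| ^ (-(1 + α))
          ≤ (K / x + (g (x + z) + g (x - z))) * |z| ^ (-(1 + α)) := by gcongr
        _ = K / x * |z| ^ (-(1 + α)) + |z| ^ (-(1 + α)) * (g (x + z) + g (x - z)) := by ring
        _ ≤ _ := by
          have : 0 ≤ g (x + z) + g (x - z) := add_nonneg (h0 _) (h0 _)
          gcongr
  have h10 : |A α g x| ≤ ∫ z, H z :=
    norm_integral_le_of_norm_le hHi (Eventually.of_forall hbd)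
  refine h10.trans ?_
  have h11 : ∫ z, H z = (x / 2) ^ (-(1 + α)) * (K * W / 2 + 2 * G) := by
    simp only [hH]
    rw [integral_const_mul, integral_add e1 e4, integral_add e2 e3, integral_const_mul,
      Measure.integral_comp_mul_left (w α), integral_add_left_eq_self g x,
      integral_sub_left_eq_self g volume x, abs_of_pos (by positivity), smul_eq_mul]
    congr 1
    field_simp
    ring
  rw [h11, div_eq_mul_one_div, Real.mul_rpow hx0.le (by norm_num)]
  have : 0 ≤ x ^ (-(1 + α)) := by positivity
  nlinarith

end FracAux

open FracAux

theorem stmt_15 (α : ℝ) (hα : α ∈ Set.Ioc (0 : ℝ) 1)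
    (V : ℝ → ℝ) (hV : ContDiff ℝ 2 V)
    (hsym : ∀ x : ℝ, V x = V (-x))
    (hL1 : Integrable (fun x => Real.exp (-(V x))))
    (hCb2 : ∃ M : ℝ, ∀ x : ℝ, Real.exp (-(V x)) ≤ M ∧
      |deriv (fun y => Real.exp (-(V y))) x| ≤ M ∧
      |deriv (deriv (fun y => Real.exp (-(V y)))) x| ≤ M)
    (hlim : ∃ M R : ℝ, ∀ x : ℝ, R ≤ |x| →
      |x| ^ 3 * Real.exp (-(V x)) * |(deriv V x) ^ 2 - deriv (deriv V) x| ≤ M)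
    (hxe : Tendsto (fun x => x * Real.exp (-(V x))) atTop (nhds 0)) :
    (∃ c₁ R : ℝ, 0 < c₁ ∧ 0 < R ∧ ∀ x : ℝ, R ≤ x →
      -fracLap1 α (fun y => Real.exp (-(V y))) x ≤ c₁ * x ^ (-(1 + α))) ∧
    (∃ c₀ r₁ : ℝ, 0 < c₀ ∧ 1 < r₁ ∧ ∀ x : ℝ, r₁ ≤ |x| →
      -c₀ * Real.exp (V x) * |x| ^ (-α) ≤ fracDrift1 α V x) := by
  obtain ⟨hα0, hα1⟩ := hα
  obtain ⟨M, hM⟩ := hCb2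
  obtain ⟨M', R, hdec⟩ := hlim
  set g : ℝ → ℝ := fun y => Real.exp (-(V y)) with hgdef
  have hg : ContDiff ℝ 2 g := hV.neg.exp
  have h0 : ∀ x, 0 ≤ g x := fun x => (Real.exp_pos _).le
  have he : ∀ x, g (-x) = g x := fun x => by simp only [hgdef]; rw [← hsym x]
  have hMb : ∀ x, |g x| ≤ M := fun x => by rw [abs_of_nonneg (h0 x)]; exact (hM x).1
  have hM2 : ∀ x, |deriv (deriv g) x| ≤ M := fun x => (hM x).2.2
  have hVd : Differentiable ℝ V := hV.differentiable (by norm_num)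
  have hVd2 : Differentiable ℝ (deriv V) := by
    have : ContDiff ℝ (1 + 1) V := by simpa [one_add_one_eq_two] using hV
    exact (contDiff_succ_iff_deriv.1 this).2.2.differentiable (by norm_num)
  have hg1 : ∀ x, HasDerivAt g (g x * (-deriv V x)) x := fun x =>
    (hVd x).hasDerivAt.neg.exp
  have hg1' : deriv g = fun x => g x * (-deriv V x) := funext fun x => (hg1 x).deriv
  have hg2 : ∀ x, deriv (deriv g) x = g x * ((deriv V x) ^ 2 - deriv (deriv V) x) := by
    intro x
    rw [hg1']
    have := ((hg1 x).mul (hVd2 x).hasDerivAt.neg).deriv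
    refine Eq.trans this ?_
    simp only [Pi.neg_apply]
    ring
  have hdec1 : ∀ x, R ≤ |x| → |x| ^ 3 * |deriv (deriv g) x| ≤ M' := by
    intro x hx
    rw [hg2, abs_mul, abs_of_nonneg (h0 x), ← mul_assoc]
    exact hdec x hx
  obtain ⟨R2, hR2⟩ := eventually_atTop.1 (hxe.eventually (ge_mem_nhds (zero_lt_one)))
  obtain ⟨C, R3, hC, hR3, hA⟩ := A_bound hα0 hα1 hg h0 hL1 (R := max R R2) (N := 1)
    (fun x hx => hdec1 x ((le_max_left _ _).trans hx))
    (fun x hx => hR2 x ((le_max_right _ _).trans hx))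
  obtain ⟨C2, hC20, hC2⟩ := dd_bound hM2 hdec1
  have hp := prod_integrable hα0 hα1 hg h0 hL1 hC20 hC2
  have hAi := A_integrable hp
  have hA0 := A_integral hL1 hp
  have hL : ∀ x, fracLap1 α g x = -(fracC α * (A α g x / 2)) := fracLap_eq hα0 hα1 hg hMb hM2
  have hc : 0 ≤ fracC α := by
    unfold fracC
    have : 0 < Real.Gamma ((1 + α) / 2) := Real.Gamma_pos_of_pos (by linarith)
    positivity
  refine ⟨⟨fracC α * C / 2 + 1, R3, by positivity, by linarith, fun x hx => ?_⟩,
    ⟨fracC α * (C / α) / 2 + 1, R3, by positivity, hR3, fun x hx => ?_⟩⟩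
  · have hx0 : 0 < x := by linarith
    have h1 := (le_abs_self _).trans (hA x hx)
    rw [hL, neg_neg]
    have h2 := mul_le_mul_of_nonneg_left h1 hc
    have h3 : 0 ≤ x ^ (-(1 + α)) := by positivity
    linarith
  · have tail : ∀ y, R3 ≤ y → |∫ u in Set.Ioi y, A α g u| ≤ C / α * y ^ (-α) := by
      intro y hy
      have hy0 : 0 < y := by linarith
      have hii : IntegrableOn (fun u : ℝ => C * u ^ (-(1 + α))) (Set.Ioi y) :=
        (integrableOn_Ioi_rpow_of_lt (by linarith) hy0).const_mul C
      have h1 : |∫ u in Set.Ioi y, A α g u| ≤ ∫ u in Set.Ioi y, C * u ^ (-(1 + α)) := by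
        rw [← Real.norm_eq_abs]
        exact norm_integral_le_of_norm_le hii
          ((ae_restrict_iff' measurableSet_Ioi).2 (Eventually.of_forall fun u hu =>
            hA u (hy.trans (le_of_lt hu))))
      refine h1.trans (le_of_eq ?_)
      rw [integral_const_mul, integral_Ioi_rpow_of_lt (by linarith) hy0]
      rw [show -(1 + α) + 1 = -α by ring]
      field_simp
    have hI : |∫ u in Set.Iic x, A α g u| ≤ C / α * |x| ^ (-α) := by
      rcases le_total 0 x with h | h
      · rw [abs_of_nonneg h] at hx ⊢
        have hsum := intervalIntegral.integral_Iic_add_Ioi (b := x) hAi.integrableOn hAi.integrableOn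
        rw [hA0] at hsum
        rw [eq_neg_of_add_eq_zero_left hsum, abs_neg]
        exact tail x hx
      · rw [abs_of_nonpos h] at hx ⊢
        rw [show (∫ u in Set.Iic x, A α g u) = ∫ u in Set.Ioi (-x), A α g u by
          rw [← integral_comp_neg_Iic]; simp only [A_even he]]
        exact tail (-x) hx
    unfold fracDrift1
    rw [show (fun u => fracLap1 α (fun y => Real.exp (-(V y))) u)
      = fun u => -(fracC α / 2) * A α g u from funext fun u => by
        rw [show (fun y => Real.exp (-(V y))) = g from rfl, hL]; ring]
    rw [integral_const_mul]
    have h1 := (abs_le.1 hI).1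
    have h2 := mul_le_mul_of_nonneg_left h1 (mul_nonneg (Real.exp_pos (V x)).le (div_nonneg hc zero_le_two))
    have h3 : 0 ≤ Real.exp (V x) * |x| ^ (-α) := by positivity
    nlinarith
end
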